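/- Fix n, k ≥ 1. Suppose u ≤_k w and x ≤_k z, that wu⁻¹ and zx⁻¹ fix every i > n, and that zx⁻¹ = σ(wu⁻¹)σ⁻¹, where σ ∈ S_∞ is the n-cycle (1 2 … n) sending i ↦ i+1 for i < n, n ↦ 1, and fixing i > n. Then the intervals [u,w]_k and [x,z]_k in the k-Bruhat order have the same number of saturated chains, where a saturated chain in [u,w]_k is a sequence u = v_0 ⋖_k v_1 ⋖_k ⋯ ⋖_k v_m = w of covers in the k-Bruhat order. -/

import Mathlib

/-- A permutation of the positive integers belongs to `S_∞` when it moves only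
finitely many points. -/
def FinSupp (w : Equiv.Perm ℕ+) : Prop := {x : ℕ+ | w x ≠ x}.Finite

/-- The length `ℓ(w)` of a permutation: its number of inversions, i.e. of pairs
`i < j` with `w i > w j`. -/
noncomputable def len (w : Equiv.Perm ℕ+) : ℕ :=
  Set.ncard {p : ℕ+ × ℕ+ | p.1 < p.2 ∧ w p.2 < w p.1}

/-- Covering relation of the `k`-Bruhat order: `u ⋖_k u(a,b)` for `a ≤ k < b`
with `ℓ(u(a,b)) = ℓ(u) + 1`.  Here `u(a,b) = u * (swap a b)`. -/
def kBruhatCov (k : ℕ+) (u w : Equiv.Perm ℕ+) : Prop :=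
  ∃ a b : ℕ+, a ≤ k ∧ k < b ∧ w = u * Equiv.swap a b ∧ len w = len u + 1

/-- The `k`-Bruhat order `u ≤_k w`: a chain of `k`-Bruhat covers from `u` to `w`
(or `u = w`). -/
def kBruhat (k : ℕ+) : Equiv.Perm ℕ+ → Equiv.Perm ℕ+ → Prop :=
  Relation.ReflTransGen (kBruhatCov k)

/-- Bounded affine maps of period `n`. -/
structure IsBoundedAffine (n : ℤ) (F : ℤ → ℤ) : Prop where
  add : ∀ v, F (v + n) = F v + n
  inj : Function.Injective F
  le : ∀ v, F v ≤ v
  ge : ∀ v, v - n ≤ F v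

/-- The affine reflection interchanging `x + n * t` and `y + n * t` for all `t`. -/
def affSwap (n x y v : ℤ) : ℤ :=
  if n ∣ v - x then v - x + y else if n ∣ v - y then v - y + x else v

/-- `F` is covered by `F ∘ affSwap n x y` among bounded affine maps. -/
structure IsStep (n : ℤ) (F : ℤ → ℤ) (x y : ℤ) : Prop where
  bdd : IsBoundedAffine n F
  lt : x < y
  ge : y - n ≤ F x
  map_lt : F x < F y
  le : F y ≤ x
  not_between : ∀ z, x < z → z < y → F z < F x ∨ F y < F z

theorem not_dvd_of_pos_lt {n d : ℤ} (h0 : 0 < d) (h1 : d < n) : ¬ n ∣ d :=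
  fun h => absurd (Int.le_of_dvd h0 h) (by omega)

theorem not_dvd_of_neg_lt {n d : ℤ} (h0 : d < 0) (h1 : -n < d) : ¬ n ∣ d := by
  rw [← dvd_neg]
  exact not_dvd_of_pos_lt (by omega) (by omega)

theorem affSwap_left (n x y : ℤ) : affSwap n x y x = y := by simp [affSwap]

theorem affSwap_right {n x y : ℤ} (h : ¬ n ∣ y - x) : affSwap n x y y = x := by
  simp [affSwap, h]

theorem affSwap_of_not_dvd {n x y v : ℤ} (h : ¬ n ∣ v - x) (h' : ¬ n ∣ v - y) :
    affSwap n x y v = v := by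
  simp [affSwap, h, h']

theorem affSwap_add_mul (n x y v t : ℤ) :
    affSwap n x y (v + n * t) = affSwap n x y v + n * t := by
  have h (c : ℤ) : n ∣ v + n * t - c ↔ n ∣ v - c := by
    rw [show v + n * t - c = (v - c) + n * t by ring]
    exact dvd_add_left (dvd_mul_right n t)
  unfold affSwap
  simp only [h]
  split_ifs <;> ring

theorem affSwap_involutive {n x y : ℤ} (h : ¬ n ∣ y - x) :
    Function.Involutive (affSwap n x y) := by
  intro v
  by_cases hx : n ∣ v - x
  · obtain ⟨t, ht⟩ := hx
    obtain rfl : v = x + n * t := by linarith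
    rw [affSwap_add_mul, affSwap_left, affSwap_add_mul, affSwap_right h]
  by_cases hy : n ∣ v - y
  · obtain ⟨t, ht⟩ := hy
    obtain rfl : v = y + n * t := by linarith
    rw [affSwap_add_mul, affSwap_right h, affSwap_add_mul, affSwap_left]
  · rw [affSwap_of_not_dvd hx hy, affSwap_of_not_dvd hx hy]

theorem IsBoundedAffine.add_mul {n : ℤ} {F : ℤ → ℤ} (hF : IsBoundedAffine n F) (v t : ℤ) :
    F (v + n * t) = F v + n * t := by
  induction t using Int.induction_on with
  | zero => simp
  | succ i ih =>
    rw [show v + n * ((i : ℤ) + 1) = (v + n * i) + n by ring, hF.add, ih]; ring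
  | pred i ih =>
    have h := hF.add (v + n * (-(i : ℤ) - 1))
    rw [show v + n * (-(i : ℤ) - 1) + n = v + n * (-(i : ℤ)) by ring, ih] at h
    linarith

namespace IsStep

variable {n : ℤ} {F : ℤ → ℤ} {x y : ℤ}

theorem lt_add (h : IsStep n F x y) : y < x + n := by
  have := h.ge; have := h.map_lt; have := h.le; omega

theorem not_dvd (h : IsStep n F x y) : ¬ n ∣ y - x :=
  not_dvd_of_pos_lt (by have := h.lt; omega) (by have := h.lt_add; omega)

theorem isBoundedAffine_comp (h : IsStep n F x y) : IsBoundedAffine n (F ∘ affSwap n x y) := by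
  have bound (v : ℤ) : F (affSwap n x y v) ≤ v ∧ v - n ≤ F (affSwap n x y v) := by
    by_cases hx : n ∣ v - x
    · obtain ⟨t, ht⟩ := hx
      obtain rfl : v = x + n * t := by linarith
      rw [affSwap_add_mul, affSwap_left, h.bdd.add_mul]
      have := h.le; have := h.map_lt; have := h.bdd.ge x
      constructor <;> linarith
    by_cases hy : n ∣ v - y
    · obtain ⟨t, ht⟩ := hy
      obtain rfl : v = y + n * t := by linarith
      rw [affSwap_add_mul, affSwap_right h.not_dvd, h.bdd.add_mul]
      have := h.ge; have := h.map_lt; have := h.bdd.le y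
      constructor <;> linarith
    · rw [affSwap_of_not_dvd hx hy]
      exact ⟨h.bdd.le v, h.bdd.ge v⟩
  refine ⟨fun v => ?_, h.bdd.inj.comp (affSwap_involutive h.not_dvd).injective,
    fun v => (bound v).1, fun v => (bound v).2⟩
  have := affSwap_add_mul n x y v 1
  rw [mul_one] at this
  simp only [Function.comp_apply, this, h.bdd.add]

end IsStep

theorem affSwap_comp_affSwap {n x j y : ℤ} (hxj : ¬ n ∣ j - x) (hjy : ¬ n ∣ y - j)
    (hxy : ¬ n ∣ y - x) :
    affSwap n x j ∘ affSwap n j y = affSwap n j y ∘ affSwap n x y ∧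
    affSwap n x y ∘ affSwap n x j = affSwap n j y ∘ affSwap n x y ∧
    affSwap n x y ∘ affSwap n j y = affSwap n j y ∘ affSwap n x j ∧
    affSwap n x j ∘ affSwap n x y = affSwap n j y ∘ affSwap n x j := by
  have hjx : ¬ n ∣ x - j := by rwa [dvd_sub_comm]
  have hyj : ¬ n ∣ j - y := by rwa [dvd_sub_comm]
  have hyx : ¬ n ∣ x - y := by rwa [dvd_sub_comm]
  have reduce (c v : ℤ) (hv : n ∣ v - c) : ∃ t, v = c + n * t :=
    hv.imp fun t ht => by linarith
  simp only [funext_iff, Function.comp_apply, ← forall_and]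
  intro v
  by_cases h1 : n ∣ v - x
  · obtain ⟨t, rfl⟩ := reduce _ _ h1
    simp [affSwap_add_mul, affSwap_left, affSwap_right hjy,
      affSwap_of_not_dvd hjx hyx, affSwap_of_not_dvd hxj hyj, affSwap_of_not_dvd hxy hjy]
  by_cases h2 : n ∣ v - j
  · obtain ⟨t, rfl⟩ := reduce _ _ h2
    simp [affSwap_add_mul, affSwap_left, affSwap_right hxj, affSwap_right hxy,
      affSwap_of_not_dvd hjx hyx, affSwap_of_not_dvd hxj hyj, affSwap_of_not_dvd hxy hjy]
  by_cases h3 : n ∣ v - y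
  · obtain ⟨t, rfl⟩ := reduce _ _ h3
    simp [affSwap_add_mul, affSwap_left, affSwap_right hjy, affSwap_right hxj, affSwap_right hxy,
      affSwap_of_not_dvd hjx hyx, affSwap_of_not_dvd hxj hyj, affSwap_of_not_dvd hxy hjy]
  · simp [affSwap_of_not_dvd h1 h2, affSwap_of_not_dvd h2 h3, affSwap_of_not_dvd h1 h3]

theorem affSwap_comm {n x y x' y' : ℤ} (hx : ¬ n ∣ x - x') (hy : ¬ n ∣ y - y')
    (hxy : ¬ n ∣ x - y') (hyx : ¬ n ∣ y - x') (h : ¬ n ∣ y - x) (h' : ¬ n ∣ y' - x') :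
    affSwap n x y ∘ affSwap n x' y' = affSwap n x' y' ∘ affSwap n x y := by
  have hx' : ¬ n ∣ x' - x := by rwa [dvd_sub_comm]
  have hy' : ¬ n ∣ y' - y := by rwa [dvd_sub_comm]
  have hxy' : ¬ n ∣ y' - x := by rwa [dvd_sub_comm]
  have hyx' : ¬ n ∣ x' - y := by rwa [dvd_sub_comm]
  have reduce (c v : ℤ) (hv : n ∣ v - c) : ∃ t, v = c + n * t :=
    hv.imp fun t ht => by linarith
  funext v
  simp only [Function.comp_apply]
  by_cases h1 : n ∣ v - x
  · obtain ⟨t, rfl⟩ := reduce _ _ h1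
    simp only [affSwap_add_mul, affSwap_left, affSwap_of_not_dvd hx hxy,
      affSwap_of_not_dvd hyx hy]
  by_cases h2 : n ∣ v - y
  · obtain ⟨t, rfl⟩ := reduce _ _ h2
    simp only [affSwap_add_mul, affSwap_right h, affSwap_of_not_dvd hx hxy,
      affSwap_of_not_dvd hyx hy]
  by_cases h3 : n ∣ v - x'
  · obtain ⟨t, rfl⟩ := reduce _ _ h3
    simp only [affSwap_add_mul, affSwap_left, affSwap_of_not_dvd hx' hyx',
      affSwap_of_not_dvd hxy' hy']
  by_cases h4 : n ∣ v - y'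
  · obtain ⟨t, rfl⟩ := reduce _ _ h4
    simp only [affSwap_add_mul, affSwap_right h', affSwap_of_not_dvd hx' hyx',
      affSwap_of_not_dvd hxy' hy']
  · rw [affSwap_of_not_dvd h1 h2, affSwap_of_not_dvd h3 h4, affSwap_of_not_dvd h1 h2]

theorem affSwap_values {n x j y : ℤ} (hxj : x < j) (hjy : j < y) (hyx : y < x + n) :
    (affSwap n x j x = j ∧ affSwap n x j j = x ∧ affSwap n x j y = y) ∧
    (affSwap n j y x = x ∧ affSwap n j y j = y ∧ affSwap n j y y = j) ∧
    (affSwap n x y x = y ∧ affSwap n x y j = j ∧ affSwap n x y y = x) ∧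
    ∀ z, x < z → z < y → z ≠ j →
      affSwap n x j z = z ∧ affSwap n j y z = z ∧ affSwap n x y z = z := by
  have d1 : ¬ n ∣ j - x := not_dvd_of_pos_lt (by omega) (by omega)
  have d2 : ¬ n ∣ y - j := not_dvd_of_pos_lt (by omega) (by omega)
  have d3 : ¬ n ∣ y - x := not_dvd_of_pos_lt (by omega) (by omega)
  have d1' : ¬ n ∣ x - j := by rwa [dvd_sub_comm]
  have d2' : ¬ n ∣ j - y := by rwa [dvd_sub_comm]
  have d3' : ¬ n ∣ x - y := by rwa [dvd_sub_comm]
  refine ⟨⟨affSwap_left .., affSwap_right d1, affSwap_of_not_dvd d3 d2⟩,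
    ⟨affSwap_of_not_dvd d1' d3', affSwap_left .., affSwap_right d2⟩,
    ⟨affSwap_left .., affSwap_of_not_dvd d1 d2', affSwap_right d3⟩, fun z h1 h2 h => ?_⟩
  have e1 : ¬ n ∣ z - x := not_dvd_of_pos_lt (by omega) (by omega)
  have e2 : ¬ n ∣ z - y := not_dvd_of_neg_lt (by omega) (by omega)
  have e3 : ¬ n ∣ z - j := by
    rcases lt_or_gt_of_ne h with h | h
    · exact not_dvd_of_neg_lt (by omega) (by omega)
    · exact not_dvd_of_pos_lt (by omega) (by omega)
  exact ⟨affSwap_of_not_dvd e1 e3, affSwap_of_not_dvd e3 e2, affSwap_of_not_dvd e1 e2⟩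

theorem left_right_iff_right_outer {n : ℤ} {F : ℤ → ℤ} {x j y : ℤ} (hxj : x < j) (hjy : j < y)
    (hyx : y < x + n) :
    IsStep n F x j ∧ IsStep n (F ∘ affSwap n x j) j y ∧ F j < F y ↔
      IsStep n F j y ∧ IsStep n (F ∘ affSwap n j y) x y := by
  obtain ⟨⟨a1, a2, a3⟩, ⟨b1, b2, b3⟩, ⟨c1, c2, c3⟩, hz⟩ := affSwap_values hxj hjy hyx
  constructor
  · rintro ⟨s, t, h⟩
    obtain ⟨hb, -, s1, s2, s3, s4⟩ := s
    obtain ⟨-, -, t1, t2, t3, t4⟩ := t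
    simp only [Function.comp_apply, a2, a3] at t1 t2 t3 t4
    have q : IsStep n F j y := by
      refine ⟨hb, ?_, ?_, ?_, ?_, ?_⟩ <;> grind
    refine ⟨q, q.isBoundedAffine_comp, ?_, ?_, ?_, ?_, ?_⟩
    all_goals try simp only [Function.comp_apply, b1, b3]
    all_goals grind
  · rintro ⟨s, t⟩
    obtain ⟨hb, -, s1, s2, s3, s4⟩ := s
    obtain ⟨-, -, t1, t2, t3, t4⟩ := t
    simp only [Function.comp_apply, b1, b3] at t1 t2 t3 t4
    have q : IsStep n F x j := by
      refine ⟨hb, ?_, ?_, ?_, ?_, ?_⟩ <;> grind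
    refine ⟨q, ⟨q.isBoundedAffine_comp, ?_, ?_, ?_, ?_, ?_⟩, ?_⟩
    all_goals try simp only [Function.comp_apply, a2, a3]
    all_goals grind

theorem left_right_iff_outer_left {n : ℤ} {F : ℤ → ℤ} {x j y : ℤ} (hxj : x < j) (hjy : j < y)
    (hyx : y < x + n) :
    IsStep n F x j ∧ IsStep n (F ∘ affSwap n x j) j y ∧ F y < F j ↔
      IsStep n F x y ∧ IsStep n (F ∘ affSwap n x y) x j := by
  obtain ⟨⟨a1, a2, a3⟩, ⟨b1, b2, b3⟩, ⟨c1, c2, c3⟩, hz⟩ := affSwap_values hxj hjy hyx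
  constructor
  · rintro ⟨s, t, h⟩
    obtain ⟨hb, -, s1, s2, s3, s4⟩ := s
    obtain ⟨-, -, t1, t2, t3, t4⟩ := t
    simp only [Function.comp_apply, a2, a3] at t1 t2 t3 t4
    have q : IsStep n F x y := by
      refine ⟨hb, ?_, ?_, ?_, ?_, ?_⟩ <;> grind
    refine ⟨q, q.isBoundedAffine_comp, ?_, ?_, ?_, ?_, ?_⟩
    all_goals try simp only [Function.comp_apply, c1, c2]
    all_goals grind
  · rintro ⟨s, t⟩
    obtain ⟨hb, -, s1, s2, s3, s4⟩ := s
    obtain ⟨-, -, t1, t2, t3, t4⟩ := t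
    simp only [Function.comp_apply, c1, c2] at t1 t2 t3 t4
    have q : IsStep n F x j := by
      refine ⟨hb, ?_, ?_, ?_, ?_, ?_⟩ <;> grind
    refine ⟨q, ⟨q.isBoundedAffine_comp, ?_, ?_, ?_, ?_, ?_⟩, ?_⟩
    all_goals try simp only [Function.comp_apply, a2, a3]
    all_goals grind

theorem right_left_iff_outer_right {n : ℤ} {F : ℤ → ℤ} {x j y : ℤ} (hxj : x < j) (hjy : j < y)
    (hyx : y < x + n) :
    IsStep n F j y ∧ IsStep n (F ∘ affSwap n j y) x j ∧ F j < F x ↔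
      IsStep n F x y ∧ IsStep n (F ∘ affSwap n x y) j y := by
  obtain ⟨⟨a1, a2, a3⟩, ⟨b1, b2, b3⟩, ⟨c1, c2, c3⟩, hz⟩ := affSwap_values hxj hjy hyx
  constructor
  · rintro ⟨s, t, h⟩
    obtain ⟨hb, -, s1, s2, s3, s4⟩ := s
    obtain ⟨-, -, t1, t2, t3, t4⟩ := t
    simp only [Function.comp_apply, b1, b2] at t1 t2 t3 t4
    have q : IsStep n F x y := by
      refine ⟨hb, ?_, ?_, ?_, ?_, ?_⟩ <;> grind
    refine ⟨q, q.isBoundedAffine_comp, ?_, ?_, ?_, ?_, ?_⟩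
    all_goals try simp only [Function.comp_apply, c2, c3]
    all_goals grind
  · rintro ⟨s, t⟩
    obtain ⟨hb, -, s1, s2, s3, s4⟩ := s
    obtain ⟨-, -, t1, t2, t3, t4⟩ := t
    simp only [Function.comp_apply, c2, c3] at t1 t2 t3 t4
    have q : IsStep n F j y := by
      refine ⟨hb, ?_, ?_, ?_, ?_, ?_⟩ <;> grind
    refine ⟨q, ⟨q.isBoundedAffine_comp, ?_, ?_, ?_, ?_, ?_⟩, ?_⟩
    all_goals try simp only [Function.comp_apply, b1, b2]
    all_goals grind

theorem right_left_iff_left_outer {n : ℤ} {F : ℤ → ℤ} {x j y : ℤ} (hxj : x < j) (hjy : j < y)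
    (hyx : y < x + n) :
    IsStep n F j y ∧ IsStep n (F ∘ affSwap n j y) x j ∧ F x < F j ↔
      IsStep n F x j ∧ IsStep n (F ∘ affSwap n x j) x y := by
  obtain ⟨⟨a1, a2, a3⟩, ⟨b1, b2, b3⟩, ⟨c1, c2, c3⟩, hz⟩ := affSwap_values hxj hjy hyx
  constructor
  · rintro ⟨s, t, h⟩
    obtain ⟨hb, -, s1, s2, s3, s4⟩ := s
    obtain ⟨-, -, t1, t2, t3, t4⟩ := t
    simp only [Function.comp_apply, b1, b2] at t1 t2 t3 t4
    have q : IsStep n F x j := by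
      refine ⟨hb, ?_, ?_, ?_, ?_, ?_⟩ <;> grind
    refine ⟨q, q.isBoundedAffine_comp, ?_, ?_, ?_, ?_, ?_⟩
    all_goals try simp only [Function.comp_apply, a1, a3]
    all_goals grind
  · rintro ⟨s, t⟩
    obtain ⟨hb, -, s1, s2, s3, s4⟩ := s
    obtain ⟨-, -, t1, t2, t3, t4⟩ := t
    simp only [Function.comp_apply, a1, a3] at t1 t2 t3 t4
    have q : IsStep n F j y := by
      refine ⟨hb, ?_, ?_, ?_, ?_, ?_⟩ <;> grind
    refine ⟨q, ⟨q.isBoundedAffine_comp, ?_, ?_, ?_, ?_, ?_⟩, ?_⟩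
    all_goals try simp only [Function.comp_apply, b1, b2]
    all_goals grind

theorem IsStep.translate {n : ℤ} {F : ℤ → ℤ} {x y : ℤ} (h : IsStep n F x y) (t : ℤ) :
    IsStep n F (x + n * t) (y + n * t) := by
  obtain ⟨hb, h0, h1, h2, h3, h4⟩ := h
  refine ⟨hb, by linarith, ?_, ?_, ?_, fun z hz hz' => ?_⟩
  · rw [hb.add_mul]; linarith
  · rw [hb.add_mul, hb.add_mul]; linarith
  · rw [hb.add_mul]; linarith
  · have := h4 (z + n * (-t)) (by linarith) (by linarith)
    rw [hb.add_mul] at this ⊢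
    rw [hb.add_mul]
    rcases this with h | h
    · left; linarith
    · right; linarith

theorem affSwap_translate (n x y t : ℤ) : affSwap n (x + n * t) (y + n * t) = affSwap n x y := by
  have h (v c : ℤ) : n ∣ v - (c + n * t) ↔ n ∣ v - c := by
    rw [show v - (c + n * t) = (v - c) - n * t by ring]
    exact dvd_sub_left (dvd_mul_right n t)
  funext v
  unfold affSwap
  simp only [h]
  split_ifs <;> ring

/-- Four integers that are pairwise incongruent modulo `n`. -/
structure PairwiseIncongruent (n x y x' y' : ℤ) : Prop where
  x_x' : ¬ n ∣ x - x'
  y_y' : ¬ n ∣ y - y'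
  x_y' : ¬ n ∣ x - y'
  y_x' : ¬ n ∣ y - x'
  y_x : ¬ n ∣ y - x
  y'_x' : ¬ n ∣ y' - x'

theorem PairwiseIncongruent.symm {n x y x' y' : ℤ} (h : PairwiseIncongruent n x y x' y') :
    PairwiseIncongruent n x' y' x y :=
  ⟨by rw [dvd_sub_comm]; exact h.x_x', by rw [dvd_sub_comm]; exact h.y_y',
    by rw [dvd_sub_comm]; exact h.y_x', by rw [dvd_sub_comm]; exact h.x_y', h.y'_x', h.y_x⟩

theorem PairwiseIncongruent.translate {n x y x' y' : ℤ} (h : PairwiseIncongruent n x y x' y')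
    (t : ℤ) : PairwiseIncongruent n (x + n * t) (y + n * t) x' y' := by
  have e (a b : ℤ) : n ∣ a + n * t - b ↔ n ∣ a - b := by
    rw [show a + n * t - b = (a - b) + n * t by ring]
    exact dvd_add_left (dvd_mul_right n t)
  exact ⟨by rw [e]; exact h.x_x', by rw [e]; exact h.y_y', by rw [e]; exact h.x_y',
    by rw [e]; exact h.y_x', by rw [add_sub_add_right_eq_sub]; exact h.y_x, h.y'_x'⟩

theorem PairwiseIncongruent.affSwap_values {n x y x' y' : ℤ}
    (h : PairwiseIncongruent n x y x' y') :
    affSwap n x y x = y ∧ affSwap n x y y = x ∧ affSwap n x y x' = x' ∧ affSwap n x y y' = y' :=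
  ⟨affSwap_left .., affSwap_right h.y_x, affSwap_of_not_dvd h.symm.x_x' h.symm.x_y',
    affSwap_of_not_dvd h.symm.y_x' h.symm.y_y'⟩

theorem IsStep.not_between_of_disjoint {n : ℤ} {F : ℤ → ℤ} {x y x' y' : ℤ}
    (hd : PairwiseIncongruent n x y x' y') (s : IsStep n F x y)
    (t : IsStep n (F ∘ affSwap n x y) x' y') :
    (x' < x → x < y' → F x < F x' ∨ F y' < F x) ∧
    (x' < y → y < y' → F y < F x' ∨ F y' < F y) ∧
    (x < x' → x' < y → F y' < F x ∨ F y < F y') ∧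
    (x < y' → y' < y → F x' < F x ∨ F y < F x') := by
  obtain ⟨a1, a2, a3, a4⟩ := hd.affSwap_values
  obtain ⟨hb, s0, s1, s2, s3, s4⟩ := s
  obtain ⟨-, t0, t1, t2, t3, t4⟩ := t
  have tx := t4 x
  have ty := t4 y
  simp only [Function.comp_apply, a1, a2, a3, a4] at t1 t2 t3 tx ty
  have sx := s4 x'
  have sy := s4 y'
  have e {a b : ℤ} (h : ¬ n ∣ a - b) : a ≠ b ∧ F a ≠ F b := by
    have : a ≠ b := by rintro rfl; simp at h
    exact ⟨this, fun h => this (hb.inj h)⟩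
  have e1 := e hd.x_x'
  have e2 := e hd.y_y'
  have e3 := e hd.x_y'
  have e4 := e hd.y_x'
  clear t4 s4
  refine ⟨?_, ?_, ?_, ?_⟩ <;> omega

theorem IsStep.comm {n : ℤ} {F : ℤ → ℤ} {x y x' y' : ℤ}
    (hd : PairwiseIncongruent n x y x' y') (s : IsStep n F x y)
    (t : IsStep n (F ∘ affSwap n x y) x' y') :
    IsStep n F x' y' ∧ IsStep n (F ∘ affSwap n x' y') x y := by
  have reduce (c v : ℤ) (hv : n ∣ v - c) : ∃ t, v = c + n * t :=
    hv.imp fun t ht => by linarith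
  obtain ⟨a1, a2, a3, a4⟩ := hd.affSwap_values
  obtain ⟨b1, b2, b3, b4⟩ := hd.symm.affSwap_values
  have key (r : ℤ) := IsStep.not_between_of_disjoint (hd.translate r) (s.translate r)
    (by rwa [affSwap_translate])
  have hb := s.bdd
  have q : IsStep n F x' y' := by
    obtain ⟨-, t0, t1, t2, t3, t4⟩ := t
    simp only [Function.comp_apply, a3, a4] at t1 t2 t3 t4
    refine ⟨hb, t0, t1, t2, t3, fun z hz hz' => ?_⟩
    by_cases h1 : n ∣ z - x
    · obtain ⟨r, rfl⟩ := reduce _ _ h1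
      exact (key r).1 hz hz'
    by_cases h2 : n ∣ z - y
    · obtain ⟨r, rfl⟩ := reduce _ _ h2
      exact (key r).2.1 hz hz'
    · simpa only [affSwap_of_not_dvd h1 h2] using t4 z hz hz'
  refine ⟨q, q.isBoundedAffine_comp, s.lt, ?_, ?_, ?_, fun z hz hz' => ?_⟩
  all_goals simp only [Function.comp_apply, b3, b4]
  · exact s.ge
  · exact s.map_lt
  · exact s.le
  · by_cases h1 : n ∣ z - x'
    · obtain ⟨r, rfl⟩ := reduce _ _ h1
      have := (key (-r)).2.2.1 (by linarith) (by linarith)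
      rw [affSwap_add_mul, b1, hb.add_mul]
      rw [hb.add_mul, hb.add_mul] at this
      rcases this with h | h
      · left; linarith
      · right; linarith
    by_cases h2 : n ∣ z - y'
    · obtain ⟨r, rfl⟩ := reduce _ _ h2
      have := (key (-r)).2.2.2 (by linarith) (by linarith)
      rw [affSwap_add_mul, b2, hb.add_mul]
      rw [hb.add_mul, hb.add_mul] at this
      rcases this with h | h
      · left; linarith
      · right; linarith
    · rw [affSwap_of_not_dvd h1 h2]
      exact s.not_between z hz hz'

open Classical in
/-- The operator evaluating a function at the result of the step exchanging `x` and `y`. -/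
noncomputable def stepOp (n x y : ℤ) : Module.End ℤ ((ℤ → ℤ) → ℤ) where
  toFun φ F := if IsStep n F x y then φ (F ∘ affSwap n x y) else 0
  map_add' φ ψ := by
    funext F
    by_cases h : IsStep n F x y <;> simp [h]
  map_smul' c φ := by
    funext F
    by_cases h : IsStep n F x y <;> simp [h]

open Classical in
theorem stepOp_apply (n x y : ℤ) (φ : (ℤ → ℤ) → ℤ) (F : ℤ → ℤ) :
    stepOp n x y φ F = if IsStep n F x y then φ (F ∘ affSwap n x y) else 0 := rfl

open Classical in
theorem stepOp_mul_apply (n x y x' y' : ℤ) (φ : (ℤ → ℤ) → ℤ) (F : ℤ → ℤ) :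
    (stepOp n x y * stepOp n x' y') φ F =
      if IsStep n F x y ∧ IsStep n (F ∘ affSwap n x y) x' y' then
        φ (F ∘ (affSwap n x y ∘ affSwap n x' y')) else 0 := by
  rw [Module.End.mul_apply, stepOp_apply, stepOp_apply, ite_and, Function.comp_assoc]

theorem stepOp_eq_zero {n x y : ℤ} (h : y ≤ x ∨ x + n ≤ y) : stepOp n x y = 0 := by
  ext φ F
  rw [stepOp_apply, if_neg]
  · rfl
  · intro s
    have := s.lt
    have := s.lt_add
    omega

theorem stepOp_mul_eq_zero {n x y x' y' : ℤ}
    (h : ∀ F, IsStep n F x y → ¬ IsStep n (F ∘ affSwap n x y) x' y') :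
    stepOp n x y * stepOp n x' y' = 0 := by
  ext φ F
  rw [stepOp_mul_apply, if_neg]
  · rfl
  · exact fun s => h F s.1 s.2

theorem ite_eq_add_ite {A B C P Q : Prop} {_ : Decidable A} {_ : Decidable B}
    {_ : Decidable C} (a : ℤ)
    (hB : A ∧ P ↔ B) (hC : A ∧ Q ↔ C) (h : A → P ∧ ¬ Q ∨ Q ∧ ¬ P) :
    (if A then a else 0) = (if B then a else 0) + if C then a else 0 := by
  by_cases hA : A
  · rcases h hA with ⟨hP, hQ⟩ | ⟨hQ, hP⟩
    · rw [if_pos hA, if_pos (hB.1 ⟨hA, hP⟩), if_neg (fun c => hQ (hC.2 c).2), add_zero]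
    · rw [if_pos hA, if_neg (fun c => hP (hB.2 c).2), if_pos (hC.1 ⟨hA, hQ⟩), zero_add]
  · rw [if_neg hA, if_neg (fun c => hA (hB.2 c).1), if_neg (fun c => hA (hC.2 c).1), add_zero]

theorem stepOp_left_mul_right {n x j y : ℤ} (hxj : x < j) (hjy : j < y) :
    stepOp n x j * stepOp n j y =
      stepOp n j y * stepOp n x y + stepOp n x y * stepOp n x j := by
  by_cases hyx : y < x + n
  · have d1 : ¬ n ∣ j - x := not_dvd_of_pos_lt (by omega) (by omega)
    have d2 : ¬ n ∣ y - j := not_dvd_of_pos_lt (by omega) (by omega)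
    have d3 : ¬ n ∣ y - x := not_dvd_of_pos_lt (by omega) (by omega)
    obtain ⟨c1, c2, -, -⟩ := affSwap_comp_affSwap d1 d2 d3
    ext φ F
    rw [LinearMap.add_apply, Pi.add_apply, stepOp_mul_apply, stepOp_mul_apply, stepOp_mul_apply,
      c1, c2]
    refine ite_eq_add_ite _ ((and_assoc).trans (left_right_iff_right_outer hxj hjy hyx))
      ((and_assoc).trans (left_right_iff_outer_left hxj hjy hyx)) (fun h => ?_)
    have hne : F j ≠ F y := fun e => hjy.ne (h.1.bdd.inj e)
    omega
  · rw [stepOp_eq_zero (n := n) (x := x) (y := y) (by omega), mul_zero, zero_mul, add_zero]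
    refine stepOp_mul_eq_zero fun F s t => ?_
    have h1 := t.ge
    rw [Function.comp_apply, affSwap_right s.not_dvd] at h1
    have := s.map_lt
    have := s.le
    omega

theorem stepOp_right_mul_left {n x j y : ℤ} (hxj : x < j) (hjy : j < y) :
    stepOp n j y * stepOp n x j =
      stepOp n x y * stepOp n j y + stepOp n x j * stepOp n x y := by
  by_cases hyx : y < x + n
  · have d1 : ¬ n ∣ j - x := not_dvd_of_pos_lt (by omega) (by omega)
    have d2 : ¬ n ∣ y - j := not_dvd_of_pos_lt (by omega) (by omega)
    have d3 : ¬ n ∣ y - x := not_dvd_of_pos_lt (by omega) (by omega)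
    obtain ⟨-, -, c1, c2⟩ := affSwap_comp_affSwap d1 d2 d3
    ext φ F
    rw [LinearMap.add_apply, Pi.add_apply, stepOp_mul_apply, stepOp_mul_apply, stepOp_mul_apply,
      c1, c2]
    refine ite_eq_add_ite _ ((and_assoc).trans (right_left_iff_outer_right hxj hjy hyx))
      ((and_assoc).trans (right_left_iff_left_outer hxj hjy hyx)) (fun h => ?_)
    have hne : F j ≠ F x := fun e => hxj.ne' (h.1.bdd.inj e)
    omega
  · rw [stepOp_eq_zero (n := n) (x := x) (y := y) (by omega), mul_zero, zero_mul, add_zero]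
    refine stepOp_mul_eq_zero fun F s t => ?_
    have h1 := t.le
    rw [Function.comp_apply, affSwap_left] at h1
    have := s.map_lt
    have := s.ge
    omega

theorem stepOp_commute {n x y x' y' : ℤ} (hd : PairwiseIncongruent n x y x' y') :
    stepOp n x y * stepOp n x' y' = stepOp n x' y' * stepOp n x y := by
  ext φ F
  have hc := affSwap_comm hd.x_x' hd.y_y' hd.x_y' hd.y_x' hd.y_x hd.y'_x'
  rw [stepOp_mul_apply, stepOp_mul_apply, hc]
  congr 1
  exact propext ⟨fun h => h.1.comm hd h.2, fun h => h.1.comm hd.symm h.2⟩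

theorem stepOp_commute_right {n x j y y' : ℤ} (hxj : x < j) (hx : j - n < x) (hy : j < y)
    (hy' : j < y') (hyn : y < j + n) (hyn' : y' < j + n) (hne : y ≠ y') :
    stepOp n x y * stepOp n j y' = stepOp n j y' * stepOp n x y := by
  have dvd_lt {a b : ℤ} (hab : a ≠ b) (h1 : a < b + n) (h2 : b < a + n) : ¬ n ∣ a - b := by
    rcases lt_or_gt_of_ne hab with h | h
    · exact not_dvd_of_neg_lt (by omega) (by omega)
    · exact not_dvd_of_pos_lt (by omega) (by omega)
  by_cases hyx : y < x + n
  · by_cases e : y' = x + n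
    · subst e
      rw [stepOp_mul_eq_zero, stepOp_mul_eq_zero]
      · intro F s t
        have h1 := t.map_lt
        have h2 := t.ge
        have h3 := t.le
        have h4 := s.map_lt
        have h5 := s.le
        have h6 := s.ge
        have h7 : affSwap n j (x + n) x = j - n := by
          have := affSwap_add_mul n j (x + n) (x + n) (-1)
          rwa [affSwap_right s.not_dvd, show x + n + n * -1 = x by ring,
            show j + n * -1 = j - n by ring] at this
        rw [Function.comp_apply, h7] at h2
        have := s.bdd.add (j - n)
        rw [sub_add_cancel] at this
        have := s.bdd.le j
        omega
      · intro F s t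
        have h1 := t.map_lt
        have h2 := t.ge
        have h3 := t.le
        have h4 := s.map_lt
        have h5 := s.le
        have h6 := s.ge
        have h7 : affSwap n x y (x + n) = y + n := by
          have := affSwap_add_mul n x y x 1
          rwa [affSwap_left, mul_one] at this
        rw [Function.comp_apply, h7, s.bdd.add] at h3
        omega
    · have hj : ¬ n ∣ x - y' := by
        by_cases hy2 : y' < x + n
        · exact not_dvd_of_neg_lt (by omega) (by omega)
        · rw [dvd_sub_comm, show y' - x = (y' - x - n) + n by ring, dvd_add_self_right]
          exact not_dvd_of_pos_lt (by omega) (by omega)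
      exact stepOp_commute ⟨dvd_lt (by omega) (by omega) (by omega),
        dvd_lt (by omega) (by omega) (by omega), hj, dvd_lt (by omega) (by omega) (by omega),
        dvd_lt (by omega) (by omega) (by omega), dvd_lt (by omega) (by omega) (by omega)⟩
  · rw [stepOp_eq_zero (n := n) (x := x) (y := y) (by omega), mul_zero, zero_mul]

theorem stepOp_commute_left {n x x' j y : ℤ} (hx : x < j) (hx' : x' < j) (hxn : j - n < x)
    (hxn' : j - n < x') (hy : j < y) (hyn : y < j + n) (hne : x ≠ x') :
    stepOp n x j * stepOp n x' y = stepOp n x' y * stepOp n x j := by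
  have dvd_lt {a b : ℤ} (hab : a ≠ b) (h1 : a < b + n) (h2 : b < a + n) : ¬ n ∣ a - b := by
    rcases lt_or_gt_of_ne hab with h | h
    · exact not_dvd_of_neg_lt (by omega) (by omega)
    · exact not_dvd_of_pos_lt (by omega) (by omega)
  by_cases hyx : y < x' + n
  · by_cases e : y = x + n
    · subst e
      rw [stepOp_mul_eq_zero, stepOp_mul_eq_zero]
      · intro F s t
        have h2 := t.ge
        have h5 := s.le
        have h7 : affSwap n x' (x + n) x = x' - n := by
          have := affSwap_add_mul n x' (x + n) (x + n) (-1)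
          rwa [affSwap_right s.not_dvd, show x + n + n * -1 = x by ring,
            show x' + n * -1 = x' - n by ring] at this
        rw [Function.comp_apply, h7] at h2
        have := s.bdd.le (x' - n)
        omega
      · intro F s t
        have h3 := t.le
        have h7 : affSwap n x j (x + n) = j + n := by
          have := affSwap_add_mul n x j x 1
          rwa [affSwap_left, mul_one] at this
        rw [Function.comp_apply, h7, s.bdd.add] at h3
        have := s.bdd.ge j
        omega
    · have hj : ¬ n ∣ x - y := by
        by_cases hy2 : y < x + n
        · exact not_dvd_of_neg_lt (by omega) (by omega)
        · rw [dvd_sub_comm, show y - x = (y - x - n) + n by ring, dvd_add_self_right]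
          exact not_dvd_of_pos_lt (by omega) (by omega)
      exact stepOp_commute ⟨dvd_lt (by omega) (by omega) (by omega),
        dvd_lt (by omega) (by omega) (by omega), hj, dvd_lt (by omega) (by omega) (by omega),
        dvd_lt (by omega) (by omega) (by omega), dvd_lt (by omega) (by omega) (by omega)⟩
  · rw [stepOp_eq_zero (n := n) (x := x') (y := y) (by omega), mul_zero, zero_mul]

theorem commute_sum_add_sum {R ι κ : Type*} [Ring R] (X : Finset ι) (Y : Finset κ)
    (m : ι → κ → R) (p : ι → R) (q : κ → R)
    (hq : ∀ x ∈ X, ∀ y ∈ Y, ∀ y' ∈ Y, y ≠ y' → m x y * q y' = q y' * m x y)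
    (hp : ∀ x ∈ X, ∀ x' ∈ X, ∀ y ∈ Y, x ≠ x' → p x * m x' y = m x' y * p x)
    (hpq : ∀ x ∈ X, ∀ y ∈ Y, p x * q y = q y * m x y + m x y * p x)
    (hqp : ∀ x ∈ X, ∀ y ∈ Y, q y * p x = m x y * q y + p x * m x y) :
    Commute (∑ x ∈ X, ∑ y ∈ Y, m x y + ∑ x ∈ X, p x)
      (∑ x ∈ X, ∑ y ∈ Y, m x y + ∑ y ∈ Y, q y) := by
  set M := ∑ x ∈ X, ∑ y ∈ Y, m x y with hM
  have e1 : M * ∑ y ∈ Y, q y - (∑ y ∈ Y, q y) * M =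
      ∑ x ∈ X, ∑ y ∈ Y, (m x y * q y - q y * m x y) := by
    rw [hM, Finset.sum_mul, Finset.mul_sum, ← Finset.sum_sub_distrib]
    refine Finset.sum_congr rfl fun x hx => ?_
    rw [Finset.sum_mul, Finset.mul_sum, ← Finset.sum_sub_distrib]
    refine Finset.sum_congr rfl fun y hy => ?_
    rw [Finset.sum_mul, Finset.mul_sum, ← Finset.sum_sub_distrib]
    exact Finset.sum_eq_single_of_mem y hy fun y' hy' h =>
      sub_eq_zero.2 (hq x hx y hy y' hy' h.symm)
  have e2 : (∑ x ∈ X, p x) * M - M * ∑ x ∈ X, p x =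
      ∑ x ∈ X, ∑ y ∈ Y, (p x * m x y - m x y * p x) := by
    rw [hM, Finset.mul_sum, Finset.sum_mul, ← Finset.sum_sub_distrib]
    refine Finset.sum_congr rfl fun x hx => ?_
    rw [Finset.mul_sum, Finset.sum_mul, ← Finset.sum_sub_distrib]
    refine Finset.sum_congr rfl fun y hy => ?_
    rw [Finset.mul_sum, Finset.sum_mul, ← Finset.sum_sub_distrib]
    exact Finset.sum_eq_single_of_mem x hx fun x' hx' h =>
      sub_eq_zero.2 (hp x' hx' x hx y hy h)
  have e3 : (∑ x ∈ X, p x) * (∑ y ∈ Y, q y) - (∑ y ∈ Y, q y) * (∑ x ∈ X, p x) =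
      ∑ x ∈ X, ∑ y ∈ Y, (p x * q y - q y * p x) := by
    simp only [Finset.sum_mul_sum, Finset.sum_sub_distrib]
    rw [Finset.sum_comm (s := Y)]
  have e4 : ∑ x ∈ X, ∑ y ∈ Y, (m x y * q y - q y * m x y) +
      ∑ x ∈ X, ∑ y ∈ Y, (p x * m x y - m x y * p x) +
      ∑ x ∈ X, ∑ y ∈ Y, (p x * q y - q y * p x) = 0 := by
    simp only [← Finset.sum_add_distrib]
    refine Finset.sum_eq_zero fun x hx => Finset.sum_eq_zero fun y hy => ?_
    rw [hpq x hx y hy, hqp x hx y hy]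
    abel
  rw [← e1, ← e2, ← e3] at e4
  rw [commute_iff_eq, ← sub_eq_zero, ← e4]
  noncomm_ring

/-- The sum of all step operators across the marker separating `v < j` from `v ≥ j`. -/
noncomputable def markerOp (n j : ℤ) : Module.End ℤ ((ℤ → ℤ) → ℤ) :=
  ∑ x ∈ Finset.Ioo (j - n) j, ∑ y ∈ Finset.Ico j (j + n), stepOp n x y

theorem markerOp_eq {n : ℤ} (hn : 0 < n) (j : ℤ) :
    markerOp n j = ∑ x ∈ Finset.Ioo (j - n) j, ∑ y ∈ Finset.Ioo j (j + n), stepOp n x y +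
      ∑ x ∈ Finset.Ioo (j - n) j, stepOp n x j := by
  rw [markerOp, ← Finset.sum_add_distrib]
  refine Finset.sum_congr rfl fun x _ => ?_
  rw [← Finset.Ioo_insert_left (by omega), Finset.sum_insert (by simp), add_comm]

theorem markerOp_succ_eq {n : ℤ} (hn : 0 < n) (j : ℤ) :
    markerOp n (j + 1) = ∑ x ∈ Finset.Ioo (j - n) j, ∑ y ∈ Finset.Ioo j (j + n), stepOp n x y +
      ∑ y ∈ Finset.Ioo j (j + n), stepOp n j y := by
  have inner (x : ℤ) (hx : x ≤ j) : ∑ y ∈ Finset.Ico (j + 1) (j + 1 + n), stepOp n x y =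
      ∑ y ∈ Finset.Ioo j (j + n), stepOp n x y := by
    symm
    refine Finset.sum_subset (fun y => by simp; omega) fun y hy hy' => stepOp_eq_zero ?_
    simp at hy hy'
    omega
  have outer : markerOp n (j + 1) =
      ∑ x ∈ Finset.Ioc (j - n) j, ∑ y ∈ Finset.Ico (j + 1) (j + 1 + n), stepOp n x y := by
    refine Finset.sum_subset (fun y => by simp; omega) fun x hx hx' => ?_
    refine Finset.sum_eq_zero fun y hy => stepOp_eq_zero ?_
    simp at hx hx' hy
    omega
  rw [outer, ← Finset.Ioo_insert_right (by omega), Finset.sum_insert (by simp), add_comm,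
    inner j le_rfl]
  congr 1
  exact Finset.sum_congr rfl fun x hx => inner x (by simp at hx; omega)

theorem markerOp_commute {n : ℤ} (hn : 0 < n) (j : ℤ) :
    Commute (markerOp n j) (markerOp n (j + 1)) := by
  rw [markerOp_eq hn, markerOp_succ_eq hn]
  simp only [commute_iff_eq]
  refine commute_sum_add_sum _ _ _ _ _ ?_ ?_ ?_ ?_
  all_goals simp only [Finset.mem_Ioo]
  · exact fun x hx y hy y' hy' => stepOp_commute_right hx.2 hx.1 hy.1 hy'.1 hy.2 hy'.2
  · exact fun x hx x' hx' y hy => stepOp_commute_left hx.2 hx'.2 hx.1 hx'.1 hy.1 hy.2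
  · exact fun x hx y hy => stepOp_left_mul_right hx.2 hy.1
  · exact fun x hx y hy => stepOp_right_mul_left hx.2 hy.1

open Classical in
/-- The indicator of the maps congruent to the identity modulo `n`. -/
noncomputable def idIndicator (n : ℤ) (F : ℤ → ℤ) : ℤ := if ∀ v, n ∣ F v - v then 1 else 0

/-- A bounded affine map congruent to the identity except that it interchanges the residues of
`x` and `j`, one step below the identity. -/
structure IsAlmostId (n : ℤ) (F : ℤ → ℤ) (x j : ℤ) : Prop where
  bdd : IsBoundedAffine n F
  left : F x = j - n
  right : F j = x
  dvd : ∀ v, ¬ n ∣ v - x → ¬ n ∣ v - j → n ∣ F v - v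

theorem IsBoundedAffine.dvd_sub_of_dvd {n : ℤ} {F : ℤ → ℤ} (hF : IsBoundedAffine n F) {v c d : ℤ}
    (hv : n ∣ v - c) (hc : n ∣ F c - d) : n ∣ F v - d := by
  obtain ⟨t, ht⟩ := hv
  obtain rfl : v = c + n * t := by linarith
  rw [hF.add_mul, show F c + n * t - d = (F c - d) + n * t by ring]
  exact dvd_add hc (dvd_mul_right n t)

theorem eq_of_dvd_sub {n a b : ℤ} (h : n ∣ a - b) (h1 : a < b + n) (h2 : b < a + n) : a = b := by
  by_contra hne
  rcases lt_or_gt_of_ne hne with h' | h'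
  · exact not_dvd_of_neg_lt (by omega) (by omega) h
  · exact not_dvd_of_pos_lt (by omega) (by omega) h

theorem IsAlmostId.between {n : ℤ} {F : ℤ → ℤ} {x j : ℤ} (h : IsAlmostId n F x j) {z : ℤ}
    (hx : ¬ n ∣ z - x) (hj : ¬ n ∣ z - j) : F z = z ∨ F z = z - n := by
  have h1 := h.dvd z hx hj
  have := h.bdd.le z
  have := h.bdd.ge z
  by_cases e : F z = z - n
  · exact Or.inr e
  · exact Or.inl (eq_of_dvd_sub h1 (by omega) (by omega))

theorem IsAlmostId.dvd_comp {n : ℤ} {F : ℤ → ℤ} {x j a b : ℤ} (h : IsAlmostId n F x j)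
    (ha : n ∣ a - x ∧ n ∣ b - j ∨ n ∣ a - j ∧ n ∣ b - x) (v : ℤ) :
    n ∣ F (affSwap n a b v) - v := by
  have hl : n ∣ F x - j := ⟨-1, by rw [h.left]; ring⟩
  have hr : n ∣ F j - x := by simp [h.right]
  have tr {p q r : ℤ} (h1 : n ∣ p - q) (h2 : n ∣ q - r) : n ∣ p - r := by
    simpa using dvd_add h1 h2
  have sy {p q : ℤ} (h1 : n ∣ p - q) : n ∣ q - p := by rwa [dvd_sub_comm]
  unfold affSwap
  split_ifs with h1 h2
  · have e : n ∣ v - a + b - b := by simpa using h1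
    rcases ha with ⟨p, q⟩ | ⟨p, q⟩
    · exact tr (h.bdd.dvd_sub_of_dvd (tr e q) hr) (sy (tr h1 p))
    · exact tr (h.bdd.dvd_sub_of_dvd (tr e q) hl) (sy (tr h1 p))
  · have e : n ∣ v - b + a - a := by simpa using h2
    rcases ha with ⟨p, q⟩ | ⟨p, q⟩
    · exact tr (h.bdd.dvd_sub_of_dvd (tr e p) hl) (sy (tr h2 q))
    · exact tr (h.bdd.dvd_sub_of_dvd (tr e p) hr) (sy (tr h2 q))
  · rcases ha with ⟨p, q⟩ | ⟨p, q⟩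
    · exact h.dvd v (fun e => h1 (tr e (sy p))) (fun e => h2 (tr e (sy q)))
    · exact h.dvd v (fun e => h2 (tr e (sy q))) (fun e => h1 (tr e (sy p)))

theorem isAlmostId_iff_left {n : ℤ} {F : ℤ → ℤ} {x j : ℤ} (hxj : x < j) (hjx : j - n < x) :
    IsStep n F x j ∧ (∀ v, n ∣ (F ∘ affSwap n x j) v - v) ↔ IsAlmostId n F x j := by
  constructor
  · rintro ⟨s, h⟩
    have hx := h x
    have hj := h j
    simp only [Function.comp_apply, affSwap_left, affSwap_right s.not_dvd] at hx hj
    have := s.ge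
    have := s.map_lt
    have := s.le
    have e1 : F j = x := eq_of_dvd_sub hx (by omega) (by omega)
    rw [← dvd_add_self_right] at hj
    have e2 : F x + n = j :=
      eq_of_dvd_sub (n := n) (by rwa [add_sub_right_comm]) (by omega) (by omega)
    refine ⟨s.bdd, by omega, e1, fun v hv hv' => ?_⟩
    have := h v
    rwa [Function.comp_apply, affSwap_of_not_dvd hv hv'] at this
  · intro h
    refine ⟨⟨h.bdd, hxj, h.left.ge, ?_, h.right.le, fun z hz hz' => ?_⟩, fun v => ?_⟩
    · rw [h.left, h.right]; exact hjx
    · rcases h.between (z := z) (not_dvd_of_pos_lt (by omega) (by omega))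
        (not_dvd_of_neg_lt (by omega) (by omega)) with e | e <;> rw [e, h.left, h.right] <;> omega
    · exact h.dvd_comp (Or.inl (by simp)) v

theorem isAlmostId_iff_right {n : ℤ} {F : ℤ → ℤ} {x j : ℤ} (hxj : x < j) (hjx : j - n < x) :
    IsStep n F j (x + n) ∧ (∀ v, n ∣ (F ∘ affSwap n j (x + n)) v - v) ↔ IsAlmostId n F x j := by
  constructor
  · rintro ⟨s, h⟩
    have hx := h (x + n)
    have hj := h j
    simp only [Function.comp_apply, affSwap_left, affSwap_right s.not_dvd] at hx hj
    have := s.ge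
    have := s.map_lt
    have := s.le
    have e1 : F (x + n) = j := eq_of_dvd_sub hj (by omega) (by omega)
    rw [← dvd_add_self_right] at hx
    have e2 : F j = x :=
      eq_of_dvd_sub (n := n) (by rwa [← sub_sub, sub_add_cancel] at hx) (by omega) (by omega)
    rw [s.bdd.add] at e1
    refine ⟨s.bdd, by omega, e2, fun v hv hv' => ?_⟩
    have := h v
    rwa [Function.comp_apply, affSwap_of_not_dvd hv' (by
      rwa [← sub_sub, dvd_sub_self_right])] at this
  · intro h
    have e := h.bdd.add x
    rw [h.left, sub_add_cancel] at e
    refine ⟨⟨h.bdd, by omega, ?_, ?_, e.le, fun z hz hz' => ?_⟩, fun v => ?_⟩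
    · rw [h.right]; omega
    · rw [e, h.right]; exact hxj
    · have d : ¬ n ∣ z - x := by
        rw [← dvd_sub_self_right]
        exact not_dvd_of_neg_lt (by omega) (by omega)
      rcases h.between d (not_dvd_of_pos_lt (by omega) (by omega)) with e' | e' <;>
        rw [e', e, h.right] <;> omega
    · exact h.dvd_comp (Or.inr (by simp)) v

theorem stepOp_idIndicator {n x j : ℤ} (hxj : x < j) (hjx : j - n < x) :
    stepOp n x j (idIndicator n) = stepOp n j (x + n) (idIndicator n) := by
  funext F
  simp only [stepOp_apply, idIndicator, ← ite_and]
  congr 1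
  exact propext ((isAlmostId_iff_left hxj hjx).trans (isAlmostId_iff_right hxj hjx).symm)

theorem markerOp_idIndicator {n : ℤ} (hn : 0 < n) (j : ℤ) :
    markerOp n j (idIndicator n) = markerOp n (j + 1) (idIndicator n) := by
  rw [markerOp_eq hn, markerOp_succ_eq hn]
  simp only [LinearMap.add_apply, LinearMap.sum_apply]
  congr 1
  refine Finset.sum_nbij' (· + n) (· - n) ?_ ?_ ?_ ?_ ?_
  · intro x; simp; omega
  · intro x; simp; omega
  · intro x; simp
  · intro x; simp
  · intro x hx
    rw [Finset.mem_Ioo] at hx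
    exact stepOp_idIndicator hx.2 hx.1

theorem markerOp_pow_idIndicator {n : ℤ} (hn : 0 < n) (j : ℤ) (m : ℕ) :
    (markerOp n j ^ m) (idIndicator n) = (markerOp n (j + 1) ^ m) (idIndicator n) := by
  induction m with
  | zero => rfl
  | succ m ih =>
    rw [pow_succ, Module.End.mul_apply, markerOp_idIndicator hn, ← Module.End.mul_apply,
      ((markerOp_commute hn j).pow_left m).eq, Module.End.mul_apply, ih, ← Module.End.mul_apply,
      ← pow_succ']

/-- Conjugation by the translation `v ↦ v + 1`. -/
def shiftMap (F : ℤ → ℤ) (v : ℤ) : ℤ := F (v - 1) + 1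

theorem IsBoundedAffine.shiftMap {n : ℤ} {F : ℤ → ℤ} (h : IsBoundedAffine n F) :
    IsBoundedAffine n (shiftMap F) where
  add v := by
    unfold _root_.shiftMap
    rw [show v + n - 1 = (v - 1) + n by ring, h.add]
    ring
  inj a b e := by
    unfold _root_.shiftMap at e
    have := h.inj (add_right_cancel e)
    omega
  le v := by
    unfold _root_.shiftMap
    have := h.le (v - 1)
    omega
  ge v := by
    unfold _root_.shiftMap
    have := h.ge (v - 1)
    omega

theorem IsBoundedAffine.of_shiftMap {n : ℤ} {F : ℤ → ℤ}
    (h : IsBoundedAffine n (_root_.shiftMap F)) :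
    IsBoundedAffine n F where
  add v := by
    have := h.add (v + 1)
    simp only [_root_.shiftMap, show v + 1 + n - 1 = v + n by ring, add_sub_cancel_right] at this
    omega
  inj a b e := by
    have := @h.inj (a + 1) (b + 1) (by simp [_root_.shiftMap, e])
    omega
  le v := by
    have := h.le (v + 1)
    simp only [_root_.shiftMap, add_sub_cancel_right] at this
    omega
  ge v := by
    have := h.ge (v + 1)
    simp only [_root_.shiftMap, add_sub_cancel_right] at this
    omega

theorem isStep_shiftMap {n : ℤ} {F : ℤ → ℤ} {x y : ℤ} :
    IsStep n (shiftMap F) (x + 1) (y + 1) ↔ IsStep n F x y := by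
  constructor
  · rintro ⟨h0, h1, h2, h3, h4, h5⟩
    simp only [shiftMap, add_sub_cancel_right] at h2 h3 h4 h5
    refine ⟨h0.of_shiftMap, by omega, by omega, by omega, by omega, fun z hz hz' => ?_⟩
    have := h5 (z + 1) (by omega) (by omega)
    rw [add_sub_cancel_right] at this
    omega
  · rintro ⟨h0, h1, h2, h3, h4, h5⟩
    refine ⟨h0.shiftMap, by omega, ?_, ?_, ?_, fun z hz hz' => ?_⟩
    all_goals simp only [shiftMap, add_sub_cancel_right]
    · omega
    · omega
    · omega
    · have := h5 (z - 1) (by omega) (by omega)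
      omega

theorem shiftMap_comp_affSwap (n x y : ℤ) (F : ℤ → ℤ) :
    shiftMap F ∘ affSwap n (x + 1) (y + 1) = shiftMap (F ∘ affSwap n x y) := by
  funext v
  have e : affSwap n (x + 1) (y + 1) v - 1 = affSwap n x y (v - 1) := by
    unfold affSwap
    rw [show v - 1 - x = v - (x + 1) by ring, show v - 1 - y = v - (y + 1) by ring]
    split_ifs <;> ring
  simp only [Function.comp_apply, shiftMap, e]

theorem stepOp_shiftMap (n x y : ℤ) (φ : (ℤ → ℤ) → ℤ) (F : ℤ → ℤ) :
    stepOp n (x + 1) (y + 1) φ (shiftMap F) = stepOp n x y (φ ∘ shiftMap) F := by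
  simp only [stepOp_apply, shiftMap_comp_affSwap, Function.comp_apply]
  congr 1
  exact propext isStep_shiftMap

theorem markerOp_shiftMap (n j : ℤ) (φ : (ℤ → ℤ) → ℤ) :
    (markerOp n (j + 1) φ) ∘ shiftMap = markerOp n j (φ ∘ shiftMap) := by
  funext F
  simp only [markerOp, LinearMap.sum_apply, Function.comp_apply, Finset.sum_apply]
  symm
  refine Finset.sum_nbij' (· + 1) (· - 1) ?_ ?_ ?_ ?_ ?_
  · intro x; simp; omega
  · intro x; simp; omega
  · intro x; simp
  · intro x; simp
  intro x _
  refine Finset.sum_nbij' (· + 1) (· - 1) ?_ ?_ ?_ ?_ ?_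
  · intro x; simp; omega
  · intro x; simp; omega
  · intro x; simp
  · intro x; simp
  · exact fun y _ => (stepOp_shiftMap n x y φ F).symm

theorem idIndicator_shiftMap (n : ℤ) : idIndicator n ∘ shiftMap = idIndicator n := by
  funext F
  have : (∀ v, n ∣ shiftMap F v - v) ↔ ∀ v, n ∣ F v - v := by
    constructor
    · intro h v
      simpa [shiftMap] using h (v + 1)
    · intro h v
      have := h (v - 1)
      rwa [show F (v - 1) - (v - 1) = shiftMap F v - v by unfold shiftMap; ring] at this
  simp only [Function.comp_apply, idIndicator]
  congr 1
  exact propext this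

/-- Counting the step sequences to the identity is invariant under the cyclic shift. -/
theorem markerOp_pow_idIndicator_shiftMap {n : ℤ} (hn : 0 < n) (j : ℤ) (m : ℕ) (F : ℤ → ℤ) :
    (markerOp n j ^ m) (idIndicator n) (shiftMap F) =
      (markerOp n j ^ m) (idIndicator n) F := by
  have key (m : ℕ) : ((markerOp n (j + 1) ^ m) (idIndicator n)) ∘ shiftMap =
      (markerOp n j ^ m) (idIndicator n) := by
    induction m with
    | zero => exact idIndicator_shiftMap n
    | succ m ih =>
      rw [pow_succ', pow_succ', Module.End.mul_apply, Module.End.mul_apply, markerOp_shiftMap, ih]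
  rw [← congrFun (key m) F, Function.comp_apply, markerOp_pow_idIndicator hn]

/-- The inversions of a permutation. -/
def inversions (u : Equiv.Perm ℕ+) : Set (ℕ+ × ℕ+) := {p | p.1 < p.2 ∧ u p.2 < u p.1}

theorem FinSupp.inversions_finite {u : Equiv.Perm ℕ+} (hu : FinSupp u) :
    (inversions u).Finite := by
  obtain ⟨N, hN⟩ := hu.bddAbove
  have fix (i : ℕ+) (hi : N < i) : u i = i := by
    by_contra h
    exact absurd (hN h) (not_le.2 hi)
  refine ((Set.finite_Iic N).prod (Set.finite_Iic N)).subset ?_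
  rintro ⟨p, q⟩ ⟨h1, h2⟩
  simp only at h1 h2
  have hp : p ≤ N := by
    by_contra h
    rw [not_le] at h
    rw [fix p h, fix q (h.trans h1)] at h2
    exact absurd h1 h2.not_gt
  have hup : u p ≤ N := by
    by_contra h
    rw [not_le] at h
    have := u.injective (fix _ h)
    rw [this] at h
    exact absurd hp h.not_ge
  refine ⟨hp, ?_⟩
  by_contra h
  simp only [Set.mem_Iic, not_le] at h
  rw [fix q h] at h2
  exact absurd (h2.trans_le hup) h.not_gt

theorem FinSupp.mul_swap {u : Equiv.Perm ℕ+} (hu : FinSupp u) (a b : ℕ+) :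
    FinSupp (u * Equiv.swap a b) := by
  refine (hu.union ((Set.finite_singleton a).union (Set.finite_singleton b))).subset fun i hi => ?_
  by_contra h
  simp only [Set.mem_union, Set.mem_ofPred_eq, Set.mem_singleton_iff, not_or, not_not] at h
  refine hi ?_
  rw [Equiv.Perm.mul_apply, Equiv.swap_apply_of_ne_of_ne h.2.1 h.2.2, h.1]

/-- The pairs in `[a, b]` having `a` as first or `b` as second entry. -/
def hookPairs (a b : ℕ+) : Set (ℕ+ × ℕ+) :=
  {p | p.1 = a ∧ p.2 ≤ b ∨ p.2 = b ∧ a ≤ p.1}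

theorem swap_mem_of_notMem_hookPairs {u : Equiv.Perm ℕ+} {a b : ℕ+} (hab : a < b) {p q : ℕ+}
    (h : (p, q) ∈ inversions (u * Equiv.swap a b) \ hookPairs a b) :
    (Equiv.swap a b p, Equiv.swap a b q) ∈ inversions u \ hookPairs a b := by
  obtain ⟨⟨h1, h2⟩, h3⟩ := h
  simp only [hookPairs, inversions, Set.mem_ofPred_eq, Equiv.Perm.mul_apply, Set.mem_sdiff] at *
  refine ⟨⟨?_, h2⟩, ?_⟩
  all_goals
    clear h2
    simp only [Equiv.swap_apply_def]
    split_ifs <;> subst_vars <;>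
      simp only [← PNat.coe_lt_coe, ← PNat.coe_le_coe, ← PNat.coe_inj, true_and, le_refl, or_self,
        not_true_eq_false] at * <;>
      omega

theorem ncard_inversions_diff_hookPairs (u : Equiv.Perm ℕ+) {a b : ℕ+} (hab : a < b) :
    (inversions (u * Equiv.swap a b) \ hookPairs a b).ncard =
      (inversions u \ hookPairs a b).ncard := by
  refine Set.ncard_congr (fun p _ => (Equiv.swap a b p.1, Equiv.swap a b p.2)) ?_ ?_ ?_
  · exact fun p hp => swap_mem_of_notMem_hookPairs hab hp
  · intro p q _ _ h
    simpa [Prod.ext_iff] using h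
  · intro p hp
    have := swap_mem_of_notMem_hookPairs (u := u * Equiv.swap a b) hab
      (p := p.1) (q := p.2) (by simpa [mul_assoc] using hp)
    exact ⟨_, this, by simp⟩

theorem len_mul_swap {u : Equiv.Perm ℕ+} (hu : FinSupp u) {a b : ℕ+} (hab : a < b)
    (h : u a < u b) :
    len (u * Equiv.swap a b) = len u +
      ((inversions (u * Equiv.swap a b) ∩ hookPairs a b) \ (inversions u ∩ hookPairs a b)).ncard := by
  have sub : inversions u ∩ hookPairs a b ⊆
      inversions (u * Equiv.swap a b) ∩ hookPairs a b := by
    rintro ⟨p, q⟩ ⟨⟨h1, h2⟩, h3⟩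
    refine ⟨⟨h1, ?_⟩, h3⟩
    simp only [hookPairs, Set.mem_ofPred_eq] at h1 h2 h3
    simp only [Equiv.Perm.mul_apply]
    rcases h3 with ⟨rfl, h3⟩ | ⟨rfl, h3⟩
    · rcases h3.lt_or_eq with h3 | rfl
      · rw [Equiv.swap_apply_left, Equiv.swap_apply_of_ne_of_ne h1.ne' h3.ne]
        exact h2.trans h
      · exact absurd h h2.not_gt
    · rcases h3.lt_or_eq with h3 | rfl
      · rw [Equiv.swap_apply_right, Equiv.swap_apply_of_ne_of_ne h3.ne' h1.ne]
        exact h.trans h2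
      · exact absurd h h2.not_gt
  have e1 := Set.ncard_inter_add_ncard_sdiff_eq_ncard (inversions u) (hookPairs a b)
    hu.inversions_finite
  have e2 := Set.ncard_inter_add_ncard_sdiff_eq_ncard (inversions (u * Equiv.swap a b))
    (hookPairs a b) (hu.mul_swap a b).inversions_finite
  have e3 := Set.ncard_sdiff_add_ncard_of_subset sub
    ((hu.mul_swap a b).inversions_finite.inter_of_left _)
  rw [ncard_inversions_diff_hookPairs u hab] at e2
  change (inversions (u * Equiv.swap a b)).ncard = (inversions u).ncard + _
  omega

theorem len_mul_swap_eq_succ_iff {u : Equiv.Perm ℕ+} (hu : FinSupp u) {a b : ℕ+} (hab : a < b) :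
    len (u * Equiv.swap a b) = len u + 1 ↔
      u a < u b ∧ ∀ c, a < c → c < b → ¬ (u a < u c ∧ u c < u b) := by
  have hne : u a ≠ u b := fun e => hab.ne (u.injective e)
  rcases lt_or_gt_of_ne hne with h | h
  · rw [len_mul_swap hu hab h, add_right_inj]
    have hmem : (a, b) ∈ (inversions (u * Equiv.swap a b) ∩ hookPairs a b) \
        (inversions u ∩ hookPairs a b) := by
      simp [inversions, hookPairs, hab, h, h.le]
    constructor
    · intro h1
      refine ⟨h, fun c hac hcb hc => ?_⟩
      obtain ⟨p, hp⟩ := Set.ncard_eq_one.1 h1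
      have hmem' : (a, c) ∈ (inversions (u * Equiv.swap a b) ∩ hookPairs a b) \
          (inversions u ∩ hookPairs a b) := by
        simp [inversions, hookPairs, hac, hcb.le, hc.1.le, hc.2,
          Equiv.swap_apply_of_ne_of_ne hac.ne' hcb.ne]
      rw [hp, Set.mem_singleton_iff] at hmem hmem'
      rw [← hmem'] at hmem
      exact hcb.ne' (Prod.ext_iff.1 hmem).2
    · rintro ⟨-, h1⟩
      rw [Set.ncard_eq_one]
      refine ⟨(a, b), Set.eq_singleton_iff_unique_mem.2 ⟨hmem, ?_⟩⟩
      rintro ⟨p, q⟩ ⟨⟨⟨h2, h3⟩, h4⟩, h5⟩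
      have h6 : ¬ u q < u p := fun h6 => h5 ⟨⟨h2, h6⟩, h4⟩
      simp only [hookPairs, Set.mem_ofPred_eq, Equiv.Perm.mul_apply] at h2 h3 h4 h6
      rcases h4 with ⟨rfl, h4⟩ | ⟨rfl, h4⟩
      · rcases h4.lt_or_eq with h4 | rfl
        · rw [Equiv.swap_apply_left, Equiv.swap_apply_of_ne_of_ne h2.ne' h4.ne] at h3
          have : u p ≠ u q := fun e => h2.ne (u.injective e)
          exact absurd ⟨lt_of_le_of_ne (not_lt.1 h6) this, h3⟩ (h1 q h2 h4)
        · rfl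
      · rcases h4.lt_or_eq with h4 | rfl
        · rw [Equiv.swap_apply_right, Equiv.swap_apply_of_ne_of_ne h4.ne' h2.ne] at h3
          have : u p ≠ u q := fun e => h2.ne (u.injective e)
          exact absurd ⟨h3, lt_of_le_of_ne (not_lt.1 h6) this⟩ (h1 p h4 h2)
        · rfl
  · have := len_mul_swap (hu.mul_swap a b) hab (by simpa using h)
    rw [mul_assoc, Equiv.swap_mul_self, mul_one] at this
    constructor
    · intro h1
      omega
    · exact fun h1 => absurd h h1.1.not_gt

/-- The value of a permutation at `a`, as an integer. -/
def intVal (u : Equiv.Perm ℕ+) (a : ℕ+) : ℤ := ((u a : ℕ) : ℤ)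

section intVal

variable (u : Equiv.Perm ℕ+) (a b : ℕ+)

theorem intVal_pos : 0 < intVal u a := by
  simp [intVal]

theorem intVal_lt_intVal {u u' : Equiv.Perm ℕ+} {a b : ℕ+} :
    intVal u a < intVal u' b ↔ u a < u' b := by
  simp [intVal]

theorem intVal_inj {u u' : Equiv.Perm ℕ+} {a b : ℕ+} :
    intVal u a = intVal u' b ↔ u a = u' b := by
  simp [intVal]

theorem intVal_ne {a b : ℕ+} (h : a ≠ b) : intVal u a ≠ intVal u b :=
  fun e => h (u.injective (intVal_inj.1 e))

theorem exists_intVal_eq {z : ℤ} (hz : 0 < z) : ∃ c, intVal u c = z := by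
  lift z to ℕ using hz.le
  lift z to ℕ+ using (by omega)
  exact ⟨u.symm z, by simp [intVal]⟩

theorem intVal_mul_swap_left : intVal (u * Equiv.swap a b) a = intVal u b := by
  simp [intVal]

theorem intVal_mul_swap_right : intVal (u * Equiv.swap a b) b = intVal u a := by
  simp [intVal]

theorem intVal_mul_swap_of_ne {a b c : ℕ+} (ha : c ≠ a) (hb : c ≠ b) :
    intVal (u * Equiv.swap a b) c = intVal u c := by
  simp [intVal, Equiv.swap_apply_of_ne_of_ne ha hb]

end intVal

theorem kBruhatCov_iff {k : ℕ+} {u v : Equiv.Perm ℕ+} (hu : FinSupp u) :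
    kBruhatCov k u v ↔ ∃ a b : ℕ+, a ≤ k ∧ k < b ∧ v = u * Equiv.swap a b ∧
      intVal u a < intVal u b ∧
      ∀ c, a < c → c < b → intVal u a < intVal u c → ¬ intVal u c < intVal u b := by
  unfold kBruhatCov
  refine exists_congr fun a => exists_congr fun b => and_congr_right fun ha =>
    and_congr_right fun hb => ?_
  constructor
  · rintro ⟨rfl, h⟩
    rw [len_mul_swap_eq_succ_iff hu (ha.trans_lt hb)] at h
    simpa only [intVal_lt_intVal, not_and, true_and] using h
  · rintro ⟨rfl, h⟩
    rw [len_mul_swap_eq_succ_iff hu (ha.trans_lt hb)]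
    simpa only [intVal_lt_intVal, not_and, true_and] using h

theorem FinSupp.of_kBruhatCov {k : ℕ+} {u v : Equiv.Perm ℕ+} (hv : FinSupp v)
    (h : kBruhatCov k u v) : FinSupp u := by
  obtain ⟨a, b, -, -, rfl, -⟩ := h
  simpa [mul_assoc] using hv.mul_swap a b

/-- The order conditions comparing permutations `u ≤_k w` entrywise. -/
structure EntrywiseBelow (k : ℕ+) (u w : Equiv.Perm ℕ+) : Prop where
  le : ∀ a ≤ k, intVal u a ≤ intVal w a
  ge : ∀ b, k < b → intVal w b ≤ intVal u b
  mono_left : ∀ c d, c < d → d ≤ k → intVal u c < intVal u d → intVal w c < intVal w d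
  mono_right : ∀ c d, c < d → k < c → intVal u c < intVal u d → intVal w c < intVal w d

theorem EntrywiseBelow.of_kBruhatCov {k : ℕ+} {u v w : Equiv.Perm ℕ+} (hu : FinSupp u)
    (huv : kBruhatCov k u v) (h : EntrywiseBelow k v w) : EntrywiseBelow k u w := by
  obtain ⟨a, b, ha, hb, rfl, hlt, hmid⟩ := (kBruhatCov_iff hu).1 huv
  have ea := intVal_mul_swap_left u a b
  have eb := intVal_mul_swap_right u a b
  have e {c} (h1 : c ≠ a) (h2 : c ≠ b) := intVal_mul_swap_of_ne u h1 h2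
  obtain ⟨h1, h2, h3, h4⟩ := h
  refine ⟨fun c hc => ?_, fun c hc => ?_, fun c d hcd hd hlt' => ?_, fun c d hcd hc hlt' => ?_⟩
  · have := h1 c hc
    by_cases hca : c = a
    · subst hca
      omega
    · rwa [e hca (hc.trans_lt hb).ne] at this
  · have := h2 c hc
    by_cases hca : c = b
    · subst hca
      omega
    · rwa [e (ha.trans_lt hc).ne' hca] at this
  · refine h3 c d hcd hd ?_
    have hdb := hd.trans_lt hb
    by_cases hca : c = a
    · subst hca
      rw [ea, e hcd.ne' hdb.ne]
      have := hmid d hcd hdb hlt'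
      have := intVal_ne u hdb.ne
      omega
    · rw [e hca (hcd.trans hdb).ne]
      by_cases hda : d = a
      · subst hda
        omega
      · rwa [e hda hdb.ne]
  · refine h4 c d hcd hc ?_
    have hac := ha.trans_lt hc
    by_cases hdb : d = b
    · subst hdb
      rw [eb, e hac.ne' hcd.ne]
      have := hmid c hac hcd
      have := intVal_ne u hac.ne
      omega
    · rw [e (hac.trans hcd).ne' hdb]
      by_cases hcb : c = b
      · subst hcb
        omega
      · rwa [e hac.ne' hcb]

theorem EntrywiseBelow.of_kBruhat {k : ℕ+} {u w : Equiv.Perm ℕ+} (hw : FinSupp w)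
    (h : kBruhat k u w) : FinSupp u ∧ EntrywiseBelow k u w := by
  induction h using Relation.ReflTransGen.head_induction_on with
  | refl => exact ⟨hw, ⟨fun _ _ => le_rfl, fun _ _ => le_rfl, fun _ _ _ _ h => h,
      fun _ _ _ _ h => h⟩⟩
  | head huv _ ih =>
    have := ih.1.of_kBruhatCov huv
    exact ⟨this, ih.2.of_kBruhatCov this huv⟩

theorem intVal_le_of_fix {n : ℤ} {u w : Equiv.Perm ℕ+}
    (h : ∀ a, n < intVal w a → intVal u a = intVal w a) {c : ℕ+} (hc : intVal w c ≤ n) :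
    intVal u c ≤ n := by
  by_contra hlt
  rw [not_le] at hlt
  obtain ⟨d, hd⟩ := exists_intVal_eq w (intVal_pos u c)
  have := h d (by omega)
  have hdc : d = c := u.injective (intVal_inj.1 (this.trans hd))
  subst hdc
  omega

/-- A bounded affine map `F` encodes the pair `u ≤ w`: it sends the value of `w` to the value
of `u` at each position, modulo `n`. -/
structure Encodes (n : ℤ) (k : ℕ+) (F : ℤ → ℤ) (u w : Equiv.Perm ℕ+) : Prop where
  bdd : IsBoundedAffine n F
  finSupp : FinSupp u
  below : EntrywiseBelow k u w
  fix : ∀ a, n < intVal w a → intVal u a = intVal w a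
  dvd : ∀ a, intVal w a ≤ n → n ∣ F (intVal w a) - intVal u a

namespace Encodes

variable {n : ℤ} {k : ℕ+} {F : ℤ → ℤ} {u w : Equiv.Perm ℕ+}

theorem le (h : Encodes n k F u w) {c : ℕ+} (hc : intVal w c ≤ n) : intVal u c ≤ n :=
  intVal_le_of_fix h.fix hc

theorem left (h : Encodes n k F u w) {c : ℕ+} (hk : c ≤ k) (hc : intVal w c ≤ n) :
    F (intVal w c) = intVal u c ∨
      intVal u c = intVal w c ∧ F (intVal w c) = intVal w c - n := by
  have h1 := h.dvd c hc
  have h2 := h.below.le c hk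
  have h3 := intVal_pos u c
  have h4 := h.bdd.le (intVal w c)
  have h5 := h.bdd.ge (intVal w c)
  by_cases e : intVal u c = intVal w c ∧ F (intVal w c) = intVal w c - n
  · exact Or.inr e
  · exact Or.inl (eq_of_dvd_sub h1 (by omega) (by omega))

theorem right (h : Encodes n k F u w) {c : ℕ+} (hk : k < c) (hc : intVal w c ≤ n) :
    F (intVal w c + n) = intVal u c ∨
      intVal u c = intVal w c ∧ F (intVal w c + n) = intVal w c + n := by
  have h1 := h.dvd c hc
  have h2 := h.below.ge c hk
  have h3 := h.le hc
  have h4 := h.bdd.le (intVal w c)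
  have h5 := h.bdd.ge (intVal w c)
  have h6 := intVal_pos w c
  rw [h.bdd.add]
  by_cases e : intVal u c = intVal w c ∧ F (intVal w c) = intVal w c
  · exact Or.inr ⟨e.1, by rw [e.2]⟩
  · refine Or.inl (eq_of_dvd_sub (n := n) ?_ (by omega) (by omega))
    rwa [add_sub_right_comm, dvd_add_self_right]

theorem isStep (h : Encodes n k F u w) {a b : ℕ+} (ha : a ≤ k) (hb : k < b)
    (hcov : kBruhatCov k u (u * Equiv.swap a b))
    (hw : EntrywiseBelow k (u * Equiv.swap a b) w) :
    IsStep n F (intVal w a) (intVal w b + n) ∧ intVal w a ≤ n ∧ intVal w b ≤ n := by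
  obtain ⟨h1, h2, h3, h4⟩ := hw
  have ea := intVal_mul_swap_left u a b
  have eb := intVal_mul_swap_right u a b
  have e {c} (h1 : c ≠ a) (h2 : c ≠ b) := intVal_mul_swap_of_ne u h1 h2
  have hcov' : intVal u a < intVal u b ∧
      ∀ c, a < c → c < b → intVal u a < intVal u c → ¬ intVal u c < intVal u b := by
    have hab := ha.trans_lt hb
    have hlt := (len_mul_swap_eq_succ_iff h.finSupp hab).1 ?_
    · simpa only [intVal_lt_intVal, not_and] using hlt
    · exact hcov.choose_spec.choose_spec.2.2.2
  obtain ⟨hlt, hmid⟩ := hcov'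
  have hwa := h1 a ha
  have hwb := h2 b hb
  rw [ea] at hwa
  rw [eb] at hwb
  have hxn : intVal w a ≤ n := by
    by_contra hc
    have := h.fix a (by omega)
    omega
  have hyn : intVal w b ≤ n := by omega
  have hua : F (intVal w a) = intVal u a := by
    have := h.left ha hxn
    omega
  have hub : F (intVal w b + n) = intVal u b := by
    have := h.right hb hyn
    omega
  have hb0 := intVal_pos w b
  refine ⟨⟨h.bdd, by omega, by omega, by omega, by omega, fun z hz hz' => ?_⟩, hxn, hyn⟩
  rw [hua, hub]
  have ha0 := intVal_pos w a
  by_cases hzn : z ≤ n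
  · obtain ⟨c, rfl⟩ := exists_intVal_eq w (show 0 < z by omega)
    have hca : c ≠ a := by
      rintro rfl
      omega
    have hca' := intVal_ne u hca
    rcases le_or_gt c k with hk | hk
    · have := h.left hk hzn
      have hcb := hk.trans_lt hb
      have hc := e hca hcb.ne
      have := intVal_ne u hcb.ne
      rcases lt_or_gt_of_ne hca with hlt' | hlt'
      · have := h1 a ha
        have := h3 c a hlt' ha
        omega
      · have := hmid c hlt' hcb
        omega
    · have := h.right hk hzn
      rw [h.bdd.add] at this
      have := h.le hzn
      have := intVal_pos u a
      omega
  · obtain ⟨c, hc⟩ := exists_intVal_eq w (show 0 < z - n by omega)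
    obtain rfl : z = intVal w c + n := by omega
    have hcn : intVal w c ≤ n := by omega
    have hcb : c ≠ b := by
      rintro rfl
      omega
    have hcb' := intVal_ne u hcb
    rcases le_or_gt c k with hk | hk
    · have := h.left hk hcn
      rw [h.bdd.add]
      have := intVal_pos u c
      omega
    · have := h.right hk hcn
      have hac := ha.trans_lt hk
      have hc := e hac.ne' hcb
      have := intVal_ne u hac.ne
      rcases lt_or_gt_of_ne hcb with hlt' | hlt'
      · have := hmid c hac hlt'
        omega
      · have := h4 b c hlt' hb
        omega

theorem exists_of_isStep (h : Encodes n k F u w) {x y : ℤ} (s : IsStep n F x y) (hx : x ≤ n)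
    (hy : n < y) :
    ∃ a b, a ≤ k ∧ k < b ∧ x = intVal w a ∧ y = intVal w b + n ∧ F x = intVal u a ∧
      F y = intVal u b ∧ kBruhatCov k u (u * Equiv.swap a b) := by
  have hn : 0 < n := by
    have := s.lt
    have := s.lt_add
    omega
  have s0 := s.lt
  have s1 := s.ge
  have s2 := s.map_lt
  have s3 := s.le
  obtain ⟨a, rfl⟩ := exists_intVal_eq w (show 0 < x by omega)
  obtain ⟨b, hyb⟩ := exists_intVal_eq w (show 0 < y - n by omega)
  obtain rfl : y = intVal w b + n := by omega
  have hb0 := intVal_pos u b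
  have ha0 := h.le hx
  have hbn : intVal w b ≤ n := by omega
  have ha : a ≤ k := by
    by_contra hk
    rw [not_le] at hk
    have := h.right hk hx
    rw [h.bdd.add] at this
    omega
  have ea : F (intVal w a) = intVal u a := by
    have := h.left ha hx
    omega
  have hb : k < b := by
    by_contra hk
    rw [not_lt] at hk
    have := h.left hk hbn
    rw [h.bdd.add] at *
    omega
  have eb : F (intVal w b + n) = intVal u b := by
    have := h.right hb hbn
    omega
  refine ⟨a, b, ha, hb, rfl, rfl, ea, eb, (kBruhatCov_iff h.finSupp).2
    ⟨a, b, ha, hb, rfl, by omega, fun c hac hcb h1 h2 => ?_⟩⟩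
  rcases le_or_gt c k with hk | hk
  · have hcn : intVal w c ≤ n := by
      by_contra hc
      have := h.fix c (by omega)
      omega
    have := h.below.mono_left a c hac hk h1
    have := s.not_between (intVal w c) this (by omega)
    have := h.left hk hcn
    omega
  · have := h.below.mono_right c b hcb hk h2
    have hcn : intVal w c ≤ n := by omega
    have := intVal_pos w c
    have := s.not_between (intVal w c + n) (by omega) (by omega)
    have := h.right hk hcn
    omega

theorem entrywiseBelow_of_isStep (h : Encodes n k F u w) {a b : ℕ+} (ha : a ≤ k) (hb : k < b)
    (s : IsStep n F (intVal w a) (intVal w b + n)) (hx : intVal w a ≤ n)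
    (ea : F (intVal w a) = intVal u a) (eb : F (intVal w b + n) = intVal u b) :
    EntrywiseBelow k (u * Equiv.swap a b) w := by
  have s0 := s.lt
  have s1 := s.ge
  have s2 := s.map_lt
  have s3 := s.le
  have s4 := s.not_between
  rw [ea] at s1 s2 s4
  rw [eb] at s2 s3 s4
  have e1 := intVal_mul_swap_left u a b
  have e2 := intVal_mul_swap_right u a b
  have e {c} (h1 : c ≠ a) (h2 : c ≠ b) := intVal_mul_swap_of_ne u h1 h2
  obtain ⟨h1, h2, h3, h4⟩ := h.below
  refine ⟨fun c hc => ?_, fun c hc => ?_, fun c d hcd hd hlt => ?_, fun c d hcd hc hlt => ?_⟩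
  · by_cases hca : c = a
    · subst hca
      omega
    · rw [e hca (hc.trans_lt hb).ne]
      exact h1 c hc
  · by_cases hcb : c = b
    · subst hcb
      omega
    · rw [e (ha.trans_lt hc).ne' hcb]
      exact h2 c hc
  · have hdb := hd.trans_lt hb
    have hcb := hcd.trans hdb
    have H := h3 c d hcd hd
    by_cases hda : d = a
    · subst hda
      rw [e hcd.ne hcb.ne] at hlt
      by_contra hle
      have := intVal_ne u hcd.ne
      have := intVal_ne w hcd.ne
      have hcn : intVal w c ≤ n := by
        by_contra hc
        have := h.fix c (by omega)
        omega
      have := intVal_pos w b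
      have := s4 (intVal w c) (by omega) (by omega)
      have := h.left (hcd.le.trans hd) hcn
      omega
    · rw [e hda hdb.ne] at hlt
      by_cases hca : c = a
      · subst hca
        exact H (by omega)
      · rw [e hca hcb.ne] at hlt
        exact H hlt
  · have hac := ha.trans_lt hc
    have had := hac.trans hcd
    have H := h4 c d hcd hc
    by_cases hcb : c = b
    · subst hcb
      rw [e had.ne' hcd.ne'] at hlt
      by_contra hle
      have := intVal_ne u hcd.ne
      have := intVal_ne w hcd.ne
      have hdn : intVal w d ≤ n := by omega
      have := intVal_pos w d
      have := s4 (intVal w d + n) (by omega) (by omega)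
      have := h.right (hc.trans hcd) hdn
      omega
    · rw [e hac.ne' hcb] at hlt
      by_cases hdb : d = b
      · subst hdb
        exact H (by omega)
      · rw [e had.ne' hdb] at hlt
        exact H hlt

theorem of_isStep (h : Encodes n k F u w) {a b : ℕ+} (ha : a ≤ k) (hb : k < b)
    (s : IsStep n F (intVal w a) (intVal w b + n)) (hx : intVal w a ≤ n)
    (ea : F (intVal w a) = intVal u a) (eb : F (intVal w b + n) = intVal u b) :
    Encodes n k (F ∘ affSwap n (intVal w a) (intVal w b + n)) (u * Equiv.swap a b) w := by
  have s0 := s.lt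
  have s1 := s.lt_add
  have hab : a ≠ b := (ha.trans_lt hb).ne
  refine ⟨s.isBoundedAffine_comp, h.finSupp.mul_swap a b,
    h.entrywiseBelow_of_isStep ha hb s hx ea eb, fun c hc => ?_, fun c hc => ?_⟩
  · have hca : c ≠ a := by
      rintro rfl
      omega
    have hcb : c ≠ b := by
      rintro rfl
      omega
    rw [intVal_mul_swap_of_ne u hca hcb]
    exact h.fix c hc
  · rw [Function.comp_apply]
    by_cases hca : c = a
    · subst hca
      rw [affSwap_left, eb, intVal_mul_swap_left, sub_self]
      exact dvd_zero n
    by_cases hcb : c = b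
    · subst hcb
      have := affSwap_add_mul n (intVal w a) (intVal w c + n) (intVal w c) 1
      rw [mul_one, affSwap_right s.not_dvd] at this
      have hbd := h.bdd.add (affSwap n (intVal w a) (intVal w c + n) (intVal w c))
      rw [← this, ea] at hbd
      rw [intVal_mul_swap_right, hbd]
      exact ⟨-1, by ring⟩
    · rw [intVal_mul_swap_of_ne u hca hcb]
      have hca' := intVal_ne w hca
      have hcb' := intVal_ne w hcb
      have := intVal_pos w a
      have := intVal_pos w b
      have := intVal_pos w c
      rw [affSwap_of_not_dvd]
      · exact h.dvd c hc
      · exact fun hd => hca' (eq_of_dvd_sub hd (by omega) (by omega))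
      · rw [← sub_sub, dvd_sub_self_right]
        exact fun hd => hcb' (eq_of_dvd_sub hd (by omega) (by omega))

end Encodes

/-- The saturated chains with `m` covers from `u` to `w`. -/
def saturatedChains (k : ℕ+) (u w : Equiv.Perm ℕ+) (m : ℕ) : Set (List (Equiv.Perm ℕ+)) :=
  {c | c.head? = some u ∧ c.getLast? = some w ∧ c.IsChain (kBruhatCov k) ∧ c.length = m + 1}

theorem mem_saturatedChains_zero {k : ℕ+} {u w : Equiv.Perm ℕ+} {c : List (Equiv.Perm ℕ+)} :
    c ∈ saturatedChains k u w 0 ↔ c = [u] ∧ u = w := by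
  constructor
  · rintro ⟨h1, h2, -, h4⟩
    obtain ⟨v, rfl⟩ := List.length_eq_one_iff.1 h4
    simp only [List.head?_cons, List.getLast?_singleton, Option.some.injEq] at h1 h2
    exact ⟨by rw [h1], h1.symm.trans h2⟩
  · rintro ⟨rfl, rfl⟩
    simp [saturatedChains]

theorem mem_saturatedChains_succ {k : ℕ+} {u w : Equiv.Perm ℕ+} {m : ℕ}
    {c : List (Equiv.Perm ℕ+)} :
    c ∈ saturatedChains k u w (m + 1) ↔
      ∃ v c', kBruhatCov k u v ∧ c = u :: c' ∧ c' ∈ saturatedChains k v w m := by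
  constructor
  · rintro ⟨h1, h2, h3, h4⟩
    match c, h1, h2, h3, h4 with
    | [_], _, _, _, h4 => simp at h4
    | p :: q :: l, h1, h2, h3, h4 =>
      simp only [List.head?_cons, Option.some.injEq] at h1
      subst h1
      rw [List.isChain_cons_cons] at h3
      exact ⟨q, q :: l, h3.1, rfl, rfl, by simpa using h2, h3.2, by simpa using h4⟩
  · rintro ⟨v, c', h, rfl, h1, h2, h3, h4⟩
    match c', h1, h2, h3, h4 with
    | q :: l, h1, h2, h3, h4 =>
      simp only [List.head?_cons, Option.some.injEq] at h1
      subst h1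
      exact ⟨rfl, by simpa using h2, List.isChain_cons_cons.2 ⟨h, h3⟩, by simpa using h4⟩

theorem kBruhat_of_mem_saturatedChains {k : ℕ+} {w : Equiv.Perm ℕ+} {m : ℕ} :
    ∀ {u c}, c ∈ saturatedChains k u w m → kBruhat k u w := by
  induction m with
  | zero =>
    intro u c h
    rw [(mem_saturatedChains_zero.1 h).2]
    exact Relation.ReflTransGen.refl
  | succ m ih =>
    intro u c h
    obtain ⟨v, c', h1, -, h2⟩ := mem_saturatedChains_succ.1 h
    exact Relation.ReflTransGen.head h1 (ih h2)

theorem len_of_mem_saturatedChains {k : ℕ+} {w : Equiv.Perm ℕ+} {m : ℕ} :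
    ∀ {u c}, c ∈ saturatedChains k u w m → len w = len u + m := by
  induction m with
  | zero =>
    intro u c h
    rw [(mem_saturatedChains_zero.1 h).2, add_zero]
  | succ m ih =>
    intro u c h
    obtain ⟨v, c', ⟨a, b, -, -, -, h1⟩, -, h2⟩ := mem_saturatedChains_succ.1 h
    rw [ih h2, h1]
    ring

theorem exists_mem_saturatedChains {k : ℕ+} {u w : Equiv.Perm ℕ+} (h : kBruhat k u w) :
    ∃ m, (saturatedChains k u w m).Nonempty := by
  induction h using Relation.ReflTransGen.head_induction_on with
  | refl => exact ⟨0, [w], mem_saturatedChains_zero.2 ⟨rfl, rfl⟩⟩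
  | head huv _ ih =>
    obtain ⟨m, c, hc⟩ := ih
    exact ⟨m + 1, _, mem_saturatedChains_succ.2 ⟨_, c, huv, rfl, hc⟩⟩

theorem swap_eq_swap_of_lt {k a b a' b' : ℕ+} (ha : a ≤ k) (hb : k < b) (hb' : k < b')
    (h : Equiv.swap a b = Equiv.swap a' b') : a = a' ∧ b = b' := by
  have h1 : Equiv.swap a' b' a = b := by rw [← h, Equiv.swap_apply_left]
  have hne : a ≠ b' := (ha.trans_lt hb').ne
  rw [Equiv.swap_apply_def, if_neg hne] at h1
  split_ifs at h1 with h2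
  · exact ⟨h2, h1.symm⟩
  · exact absurd h1 (ha.trans_lt hb).ne

namespace Encodes

variable {n : ℤ} {k : ℕ+} {F : ℤ → ℤ} {u w : Equiv.Perm ℕ+}

theorem forall_dvd_iff (hn : 0 < n) (h : Encodes n k F u w) :
    (∀ v, n ∣ F v - v) ↔ u = w := by
  constructor
  · intro hv
    ext c
    rw [← intVal_inj]
    by_cases hc : intVal w c ≤ n
    · have h1 := dvd_sub (hv (intVal w c)) (h.dvd c hc)
      rw [sub_sub_sub_cancel_left] at h1
      have := h.le hc
      have := intVal_pos u c
      have := intVal_pos w c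
      exact eq_of_dvd_sub h1 (by omega) (by omega)
    · exact h.fix c (by omega)
  · rintro rfl v
    have h1 := Int.emod_nonneg (v - 1) hn.ne'
    have h2 := Int.emod_lt_of_pos (v - 1) hn
    have h3 := Int.emod_add_mul_ediv (v - 1) n
    obtain ⟨c, hc⟩ := exists_intVal_eq u (show 0 < (v - 1) % n + 1 by omega)
    have h4 := h.dvd c (by omega)
    have hv : v = intVal u c + n * ((v - 1) / n) := by omega
    rw [hv, h.bdd.add_mul, add_sub_add_right_eq_sub]
    exact h4

theorem exists_finset_of_stepOp (h : Encodes n k F u w) (hw : FinSupp w) (m : ℕ)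
    (ih : ∀ F u, Encodes n k F u w → ∃ s : Finset (List (Equiv.Perm ℕ+)),
      (∀ c, c ∈ s ↔ c ∈ saturatedChains k u w m) ∧
      (s.card : ℤ) = (markerOp n (n + 1) ^ m) (idIndicator n) F)
    {x y : ℤ} (hx : x ≤ n) (hy : n < y) :
    ∃ s : Finset (List (Equiv.Perm ℕ+)),
      (∀ c, c ∈ s ↔ ∃ a b c', a ≤ k ∧ k < b ∧ x = intVal w a ∧ y = intVal w b + n ∧
        kBruhatCov k u (u * Equiv.swap a b) ∧ c = u :: c' ∧
        c' ∈ saturatedChains k (u * Equiv.swap a b) w m) ∧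
      (s.card : ℤ) = stepOp n x y ((markerOp n (n + 1) ^ m) (idIndicator n)) F := by
  classical
  rw [stepOp_apply]
  by_cases hs : IsStep n F x y
  · obtain ⟨a, b, ha, hb, rfl, rfl, ea, eb, hcov⟩ := h.exists_of_isStep hs hx hy
    obtain ⟨s, hs1, hs2⟩ := ih _ _ (h.of_isStep ha hb hs hx ea eb)
    refine ⟨s.image (u :: ·), fun c => ?_, ?_⟩
    · simp only [Finset.mem_image, hs1]
      constructor
      · rintro ⟨c', h1, rfl⟩
        exact ⟨a, b, c', ha, hb, rfl, rfl, hcov, rfl, h1⟩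
      · rintro ⟨a', b', c', -, -, e1, e2, -, rfl, h1⟩
        obtain rfl : a = a' := w.injective (intVal_inj.1 e1)
        obtain rfl : b = b' := w.injective (intVal_inj.1 (add_right_cancel e2))
        exact ⟨c', h1, rfl⟩
    · rw [if_pos hs, ← hs2, Finset.card_image_of_injective _ (List.cons_injective)]
  · refine ⟨∅, fun c => ?_, by rw [if_neg hs]; simp⟩
    simp only [Finset.notMem_empty, false_iff]
    rintro ⟨a, b, c', ha, hb, rfl, rfl, hcov, -, h1⟩
    exact hs (h.isStep ha hb hcov
      (EntrywiseBelow.of_kBruhat hw (kBruhat_of_mem_saturatedChains h1)).2).1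

/-- The marker operator counts the saturated chains of a pair encoded by `F`. -/
theorem exists_finset_saturatedChains (hn : 0 < n) (hw : FinSupp w) (m : ℕ) :
    ∀ F u, Encodes n k F u w → ∃ s : Finset (List (Equiv.Perm ℕ+)),
      (∀ c, c ∈ s ↔ c ∈ saturatedChains k u w m) ∧
      (s.card : ℤ) = (markerOp n (n + 1) ^ m) (idIndicator n) F := by
  classical
  induction m with
  | zero =>
    intro F u h
    rw [pow_zero, Module.End.one_apply, idIndicator]
    by_cases e : u = w
    · refine ⟨{[u]}, fun c => ?_, ?_⟩
      · simp [mem_saturatedChains_zero, e]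
      · rw [if_pos ((h.forall_dvd_iff hn).2 e)]
        simp
    · refine ⟨∅, fun c => ?_, ?_⟩
      · simp [mem_saturatedChains_zero, e]
      · rw [if_neg (fun h' => e ((h.forall_dvd_iff hn).1 h'))]
        simp
  | succ m ih =>
    intro F u h
    let T := Finset.Ioo (n + 1 - n) (n + 1) ×ˢ Finset.Ico (n + 1) (n + 1 + n)
    have hT (p : ℤ × ℤ) (hp : p ∈ T) := h.exists_finset_of_stepOp hw m ih
      (x := p.1) (y := p.2) (by simp [T] at hp; omega) (by simp [T] at hp; omega)
    choose! g hg1 hg2 using hT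
    refine ⟨T.biUnion g, fun c => ?_, ?_⟩
    · rw [Finset.mem_biUnion, mem_saturatedChains_succ]
      constructor
      · rintro ⟨p, hp, hc⟩
        obtain ⟨a, b, c', -, -, -, -, h1, h2, h3⟩ := (hg1 p hp c).1 hc
        exact ⟨_, c', h1, h2, h3⟩
      · rintro ⟨v, c', h1, h2, h3⟩
        have hcov := h1
        obtain ⟨a, b, ha, hb, rfl, -⟩ := h1
        obtain ⟨hs, hx, hy⟩ := h.isStep ha hb hcov
          (EntrywiseBelow.of_kBruhat hw (kBruhat_of_mem_saturatedChains h3)).2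
        have := hs.lt_add
        have := intVal_pos w b
        have hp : (intVal w a, intVal w b + n) ∈ T := by
          simp only [T, Finset.mem_product, Finset.mem_Ioo, Finset.mem_Ico]
          omega
        exact ⟨_, hp, (hg1 _ hp c).2 ⟨a, b, c', ha, hb, rfl, rfl, hcov, h2, h3⟩⟩
    · rw [Finset.card_biUnion, pow_succ', Module.End.mul_apply, markerOp]
      · push_cast
        rw [Finset.sum_congr rfl hg2, Finset.sum_product]
        simp only [Finset.sum_apply]
        rfl
      · intro p hp p' hp' hne
        rw [Function.onFun, Finset.disjoint_left]
        intro c hc hc'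
        obtain ⟨a, b, c₁, ha, hb, e1, e2, -, h2, h3⟩ := (hg1 p hp c).1 hc
        obtain ⟨a', b', c₂, ha', hb', e1', e2', -, h2', h3'⟩ := (hg1 p' hp' c).1 hc'
        rw [h2] at h2'
        obtain rfl := List.cons_injective h2'
        have e := h3.1.symm.trans h3'.1
        rw [Option.some.injEq, mul_right_inj] at e
        obtain ⟨rfl, rfl⟩ := swap_eq_swap_of_lt ha hb hb' e
        exact hne (Prod.ext (e1.trans e1'.symm) (e2.trans e2'.symm))

end Encodes

theorem exists_encodes {n k : ℕ+} {u w : Equiv.Perm ℕ+} (hu : FinSupp u)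
    (hb : EntrywiseBelow k u w) (hfix : ∀ a, (n : ℤ) < intVal w a → intVal u a = intVal w a) :
    ∃ F, Encodes n k F u w := by
  classical
  have hn : (0 : ℤ) < n := by exact_mod_cast n.pos
  have hres (v : ℤ) : ∃ c q, v = intVal w c + n * q ∧ intVal w c ≤ n := by
    have h1 := Int.emod_nonneg (v - 1) hn.ne'
    have h2 := Int.emod_lt_of_pos (v - 1) hn
    have h3 := Int.emod_add_mul_ediv (v - 1) n
    obtain ⟨c, hc⟩ := exists_intVal_eq w (show 0 < (v - 1) % n + 1 by omega)
    exact ⟨c, (v - 1) / n, by omega, by omega⟩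
  choose c q hv hc using hres
  have huniq {v : ℤ} {d : ℕ+} {t : ℤ} (hd : intVal w d ≤ n) (h : v = intVal w d + n * t) :
      c v = d ∧ q v = t := by
    have h1 := hv v
    have h2 := hc v
    have h3 := intVal_pos w d
    have h4 := intVal_pos w (c v)
    have e : intVal w (c v) = intVal w d :=
      eq_of_dvd_sub (n := n) ⟨t - q v, by linear_combination h - h1⟩ (by omega) (by omega)
    refine ⟨w.injective (intVal_inj.1 e), mul_left_cancel₀ hn.ne' ?_⟩
    linear_combination h - h1 - e
  refine ⟨fun v => (if c v ≤ k then intVal u (c v) else intVal u (c v) - n) + n * q v,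
    ⟨fun v => ?_, fun v v' h => ?_, fun v => ?_, fun v => ?_⟩, hu, hb, hfix, fun a ha => ?_⟩
  · obtain ⟨h1, h2⟩ := huniq (v := v + n) (t := q v + 1) (hc v) (by linear_combination hv v)
    simp only [h1, h2]
    ring
  · have h1 := intVal_pos u (c v)
    have h2 := intVal_pos u (c v')
    have h3 := intVal_le_of_fix hfix (hc v)
    have h4 := intVal_le_of_fix hfix (hc v')
    have e : intVal u (c v) = intVal u (c v') := by
      refine eq_of_dvd_sub (n := n) ?_ (by omega) (by omega)
      split_ifs at h
      · exact ⟨q v' - q v, by linear_combination h⟩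
      · exact ⟨q v' - q v - 1, by linear_combination h⟩
      · exact ⟨q v' - q v + 1, by linear_combination h⟩
      · exact ⟨q v' - q v, by linear_combination h⟩
    have ec : c v = c v' := u.injective (intVal_inj.1 e)
    simp only [ec, add_right_inj] at h
    rw [hv v, hv v', ec, h]
  · have h1 := intVal_le_of_fix hfix (hc v)
    have h2 := intVal_pos w (c v)
    have h3 := hv v
    split_ifs with hk
    · have := hb.le _ hk
      omega
    · omega
  · have h1 := intVal_pos u (c v)
    have h2 := hc v
    have h3 := hv v
    split_ifs with hk
    · omega
    · have := hb.ge _ (not_le.1 hk)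
      omega
  · obtain ⟨h1, h2⟩ := huniq (v := intVal w a) (t := 0) ha (by ring)
    simp only [h1, h2]
    split_ifs
    · simp
    · exact ⟨-1, by ring⟩

theorem intVal_eq_of_mul_inv_fixes {n : ℕ+} {u w : Equiv.Perm ℕ+}
    (h : ∀ i, n < i → (w * u⁻¹) i = i) (a : ℕ+) (ha : (n : ℤ) < intVal w a) :
    intVal u a = intVal w a := by
  have h1 : (w * u⁻¹) (w a) = w a := h _ (by simpa [intVal] using ha)
  rw [Equiv.Perm.mul_apply, w.injective.eq_iff, Equiv.Perm.inv_eq_iff_eq] at h1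
  rw [intVal_inj, h1]

/-- Conjugation by the long cycle acts on encodings by `shiftMap`. -/
theorem Encodes.shiftMap {n k : ℕ+} {F : ℤ → ℤ} {u w x z σ : Equiv.Perm ℕ+}
    (h : Encodes n k F u w) (hx : FinSupp x) (hb : EntrywiseBelow k x z)
    (hfix : ∀ a, (n : ℤ) < intVal z a → intVal x a = intVal z a)
    (hσ₁ : ∀ i : ℕ+, i < n → σ i = i + 1) (hσ₂ : σ n = 1) (hσ₃ : ∀ i : ℕ+, n < i → σ i = i)
    (hconj : z * x⁻¹ = σ * (w * u⁻¹) * σ⁻¹) : Encodes n k (_root_.shiftMap F) x z := by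
  have hσ (i : ℕ+) (hi : ((σ i : ℕ) : ℤ) ≤ n) :
      ((i : ℕ) : ℤ) ≤ n ∧ (n : ℤ) ∣ ((σ i : ℕ) : ℤ) - 1 - ((i : ℕ) : ℤ) := by
    rcases lt_trichotomy i n with hin | rfl | hin
    · have : ((i : ℕ) : ℤ) ≤ n := by exact_mod_cast hin.le
      rw [hσ₁ i hin]
      simpa using this
    · rw [hσ₂]
      simp
    · rw [hσ₃ i hin] at hi
      exact absurd (by exact_mod_cast hi) (not_le.2 hin)
  refine ⟨h.bdd.shiftMap, hx, hb, hfix, fun c hc => ?_⟩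
  obtain ⟨a, ha⟩ : ∃ a, x c = σ (u a) := ⟨u⁻¹ (σ⁻¹ (x c)), by simp⟩
  have hz : z c = σ (w a) := by
    have hxa : x⁻¹ (σ (u a)) = c := by simp [← ha]
    have := congrArg (fun p : Equiv.Perm ℕ+ => p (σ (u a))) hconj
    rw [Equiv.Perm.mul_apply, hxa] at this
    simpa using this
  have hc' := intVal_le_of_fix hfix hc
  simp only [intVal, ha, hz] at hc hc' ⊢
  obtain ⟨h1, h2⟩ := hσ _ hc
  obtain ⟨-, h4⟩ := hσ _ hc'
  have h5 := h.bdd.dvd_sub_of_dvd h2 (h.dvd a h1)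
  obtain ⟨t, ht⟩ := dvd_sub h5 h4
  rw [intVal] at ht
  exact ⟨t, by rw [_root_.shiftMap]; linear_combination ht⟩

theorem Encodes.ncard_saturatedChains {n : ℤ} {k : ℕ+} {F : ℤ → ℤ} {u w : Equiv.Perm ℕ+}
    (h : Encodes n k F u w) (hn : 0 < n) (hw : FinSupp w) (m : ℕ) :
    ((saturatedChains k u w m).ncard : ℤ) = (markerOp n (n + 1) ^ m) (idIndicator n) F ∧
      (saturatedChains k u w m).Finite := by
  obtain ⟨s, h1, h2⟩ := exists_finset_saturatedChains hn hw m F u h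
  have : saturatedChains k u w m = s := by
    ext c
    rw [Finset.mem_coe, h1]
  rw [this, Set.ncard_coe_finset]
  exact ⟨h2, s.finite_toSet⟩

theorem setOf_isChain_eq_saturatedChains {k : ℕ+} {u w : Equiv.Perm ℕ+} {m : ℕ}
    (h : (saturatedChains k u w m).Nonempty) :
    {c : List (Equiv.Perm ℕ+) | c.head? = some u ∧ c.getLast? = some w ∧
      c.IsChain (kBruhatCov k)} = saturatedChains k u w m := by
  ext c
  refine ⟨fun ⟨h1, h2, h3⟩ => ?_, fun hc => ⟨hc.1, hc.2.1, hc.2.2.1⟩⟩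
  have hpos : 0 < c.length := by
    rw [List.length_pos_iff]
    rintro rfl
    simp at h1
  have hc : c ∈ saturatedChains k u w (c.length - 1) := ⟨h1, h2, h3, by omega⟩
  obtain ⟨d, hd⟩ := h
  have := len_of_mem_saturatedChains hc
  have := len_of_mem_saturatedChains hd
  obtain rfl : m = c.length - 1 := by omega
  exact hc

/-- Cyclic shift (chain-counting corollary).  Suppose `u ≤_k w`, `x ≤_k z`,
`wu⁻¹` and `zx⁻¹` lie in `S_n`, and `zx⁻¹ = σ (wu⁻¹) σ⁻¹` where `σ` is the
`n`-cycle `(1 2 … n)`.  Then the intervals `[u,w]_k` and `[x,z]_k` have the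
same number of saturated chains; a saturated chain is recorded as the list
`[v_0, v_1, …, v_m]` with `v_0 = u`, `v_m = w`, and each consecutive pair a
cover of the `k`-Bruhat order. -/
theorem stmt_17 (n k : ℕ+) (u w x z σ : Equiv.Perm ℕ+)
    (hu : FinSupp u) (hw : FinSupp w) (hx : FinSupp x) (hz : FinSupp z)
    (hσ₁ : ∀ i : ℕ+, i < n → σ i = i + 1) (hσ₂ : σ n = 1)
    (hσ₃ : ∀ i : ℕ+, n < i → σ i = i)
    (huw : kBruhat k u w) (hxz : kBruhat k x z)
    (hwu : ∀ i : ℕ+, n < i → (w * u⁻¹) i = i)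
    (hzx : ∀ i : ℕ+, n < i → (z * x⁻¹) i = i)
    (hconj : z * x⁻¹ = σ * (w * u⁻¹) * σ⁻¹) :
    Set.ncard {c : List (Equiv.Perm ℕ+) | c.head? = some u ∧ c.getLast? = some w ∧
        List.Chain' (kBruhatCov k) c} =
    Set.ncard {c : List (Equiv.Perm ℕ+) | c.head? = some x ∧ c.getLast? = some z ∧
        List.Chain' (kBruhatCov k) c} := by
  obtain ⟨hu', hb⟩ := EntrywiseBelow.of_kBruhat hw huw
  obtain ⟨hx', hb'⟩ := EntrywiseBelow.of_kBruhat hz hxz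
  have hn : (0 : ℤ) < n := by exact_mod_cast n.pos
  obtain ⟨F, hF⟩ := exists_encodes hu' hb (intVal_eq_of_mul_inv_fixes hwu)
  have hF' := hF.shiftMap hx' hb' (intVal_eq_of_mul_inv_fixes hzx) hσ₁ hσ₂ hσ₃ hconj
  obtain ⟨m, hm⟩ := exists_mem_saturatedChains huw
  obtain ⟨h1, h2⟩ := hF.ncard_saturatedChains hn hw m
  obtain ⟨h3, -⟩ := hF'.ncard_saturatedChains hn hz m
  rw [markerOp_pow_idIndicator_shiftMap hn, ← h1, Nat.cast_inj] at h3
  have hm' : (saturatedChains k x z m).Nonempty :=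
    Set.nonempty_of_ncard_ne_zero (h3 ▸ ((Set.ncard_pos h2).2 hm).ne')
  exact (congrArg Set.ncard (setOf_isChain_eq_saturatedChains hm)).trans
    (h3.symm.trans (congrArg Set.ncard (setOf_isChain_eq_saturatedChains hm')).symm)
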